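/- Lemma 1: The set Γ = { z ∈ ℂ : Re ∫_{ζ₋}^z ((t−ζ₊)(t−ζ₋))^{1/2}/(t²−1) dt = 0 } is the union of three analytic arcs Γ_L, Γ_C, Γ_R. All three arcs connect the two points ζ₊ and ζ₋, and each arc intersects the real line in exactly one point, in such a way that each of the three intervals (−∞,−1), (−1,1), (1,∞) is cut by exactly one of the arcs (Γ_L cuts (−∞,−1), Γ_C cuts (−1,1), Γ_R cuts (1,∞)). -/

import Mathlib

open Complex Set Filter Topology

noncomputable section

/-- The branch point `ζ₊`. -/
def zetaP (A B : ℝ) : ℂ :=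
  (((B : ℂ) ^ 2 - (A : ℂ) ^ 2) +
      4 * Complex.I * ((Real.sqrt ((A + 1) * (B + 1) * (-A - B - 1)) : ℝ) : ℂ)) /
    ((A : ℂ) + (B : ℂ) + 2) ^ 2

/-- The branch point `ζ₋`. -/
def zetaM (A B : ℝ) : ℂ :=
  (((B : ℂ) ^ 2 - (A : ℂ) ^ 2) -
      4 * Complex.I * ((Real.sqrt ((A + 1) * (B + 1) * (-A - B - 1)) : ℝ) : ℂ)) /
    ((A : ℂ) + (B : ℂ) + 2) ^ 2

/-- The set `Γ = { z : Re ∫_{ζ₋}^z ((t−ζ₊)(t−ζ₋))^{1/2}/(t²−1) dt = 0 }`, where the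
integral is taken along any C¹ path avoiding `±1`, with any continuous branch of the
square root along the path (the real part is independent of these choices). -/
def GammaSet (A B : ℝ) : Set ℂ :=
  {z | ∃ γ g : ℝ → ℂ, ContDiff ℝ 1 γ ∧ γ 0 = zetaM A B ∧ γ 1 = z ∧
    (∀ t ∈ Set.Icc (0 : ℝ) 1, γ t ≠ 1 ∧ γ t ≠ -1) ∧
    ContinuousOn g (Set.Icc 0 1) ∧
    (∀ t ∈ Set.Icc (0 : ℝ) 1, g t ^ 2 = (γ t - zetaP A B) * (γ t - zetaM A B)) ∧
    (∫ t in (0:ℝ)..1, g t / ((γ t) ^ 2 - 1) * deriv γ t).re = 0}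

/-- `s` is an analytic arc joining `a` to `b` : it is the image of an injective
real-analytic regular curve on `[0,1]` with endpoints `a` and `b`. -/
def IsAnalyticArc (s : Set ℂ) (a b : ℂ) : Prop :=
  ∃ γ : ℝ → ℂ, AnalyticOnNhd ℝ γ (Set.Icc 0 1) ∧ Set.InjOn γ (Set.Icc 0 1) ∧
    (∀ t ∈ Set.Icc (0 : ℝ) 1, deriv γ t ≠ 0) ∧
    γ 0 = a ∧ γ 1 = b ∧ γ '' Set.Icc 0 1 = s


/-! ### Part 1 -/

/-- The series `∑ z^m/(2m+3)`. -/
def Lf (z : ℝ) : ℝ := ∑' m : ℕ, (1 / (2 * (m : ℝ) + 3)) * z ^ m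

lemma Lf_summable {z : ℝ} (hz : |z| < 1) :
    Summable (fun m : ℕ => (1 / (2 * (m : ℝ) + 3)) * z ^ m) := by
  refine Summable.of_norm_bounded (g := fun m : ℕ => |z| ^ m)
    (summable_geometric_of_lt_one (abs_nonneg z) hz) ?_
  intro m
  rw [norm_mul, norm_pow, Real.norm_eq_abs, Real.norm_eq_abs]
  have h1 : |1 / (2 * (m : ℝ) + 3)| ≤ 1 := by
    rw [abs_of_nonneg (by positivity), div_le_one (by positivity)]
    have : (0 : ℝ) ≤ m := Nat.cast_nonneg m
    linarith
  exact mul_le_of_le_one_left (by positivity) h1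

lemma Lf_analyticAt {z : ℝ} (hz : |z| < 1) : AnalyticAt ℝ Lf z := by
  have hrad : (FormalMultilinearSeries.ofScalars ℝ (fun m : ℕ => 1 / (2 * (m : ℝ) + 3))).radius
      = ENNReal.ofNNReal (1 : NNReal)⁻¹ := by
    apply FormalMultilinearSeries.ofScalars_radius_eq_inv_of_tendsto ℝ _ one_ne_zero
    have : Tendsto (fun n : ℕ => (2 * (n : ℝ) + 3) / (2 * (n : ℝ) + 5)) atTop (𝓝 1) := by
      have h2 : Tendsto (fun n : ℕ => 1 - 2 / (2 * (n : ℝ) + 5)) atTop (𝓝 (1 - 0)) := by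
        apply Tendsto.const_sub
        apply Tendsto.div_atTop tendsto_const_nhds
        apply tendsto_atTop_add_const_right
        exact tendsto_natCast_atTop_atTop.const_mul_atTop (by norm_num)
      rw [sub_zero] at h2
      refine h2.congr fun n => ?_
      have : (2 * (n : ℝ) + 5) ≠ 0 := by positivity
      field_simp
      ring
    refine this.congr fun n => ?_
    rw [Real.norm_of_nonneg (by positivity), Real.norm_of_nonneg (by positivity)]
    have : (2 * (n : ℝ) + 5) ≠ 0 := by positivity
    push_cast
    field_simp
    ring
  have hball := (FormalMultilinearSeries.ofScalars ℝ
    (fun m : ℕ => 1 / (2 * (m : ℝ) + 3))).hasFPowerSeriesOnBall (by rw [hrad]; simp)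
  have heq : (FormalMultilinearSeries.ofScalars ℝ (fun m : ℕ => 1 / (2 * (m : ℝ) + 3))).sum = Lf := by
    funext x
    rw [Lf, FormalMultilinearSeries.sum]
    refine tsum_congr fun m => ?_
    rw [FormalMultilinearSeries.ofScalars_apply_eq]
    simp
  rw [heq, hrad] at hball
  refine hball.analyticAt_of_mem ?_
  simpa [Metric.mem_eball, edist_dist, Real.dist_eq] using hz

lemma Lf_zero : Lf 0 = 1 / 3 := by
  rw [Lf, tsum_eq_single 0]
  · simp
  · intro m hm; simp [hm]

lemma Lf_mono {x y : ℝ} (hx : 0 ≤ x) (hxy : x ≤ y) (hy : y < 1) : Lf x ≤ Lf y := by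
  refine Summable.tsum_le_tsum (fun m => ?_) (Lf_summable (by rw [abs_of_nonneg hx]; linarith))
    (Lf_summable (by rw [abs_of_nonneg (hx.trans hxy)]; linarith))
  gcongr

lemma Lf_pos {x : ℝ} (hx : 0 ≤ x) (hy : x < 1) : 0 < Lf x := by
  have := Lf_mono le_rfl hx hy
  rw [Lf_zero] at this
  linarith

/-- artanh -/
def Ath (x : ℝ) : ℝ := (1 / 2) * (Real.log (1 + x) - Real.log (1 - x))

lemma Ath_eq {x : ℝ} (hx : |x| < 1) : Ath x = x + x ^ 3 * Lf (x ^ 2) := by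
  have h := Real.hasSum_log_sub_log_of_abs_lt_one hx
  have h2 := (h.mul_left (1/2 : ℝ))
  have h3 := h2.tsum_eq
  rw [Ath, ← h3, h2.summable.tsum_eq_zero_add, Lf, ← tsum_mul_left]
  congr 1
  · norm_num; ring
  · refine tsum_congr fun m => ?_
    push_cast
    have : (2 * (m : ℝ) + 3) ≠ 0 := by positivity
    have h' : (2 * ((m : ℝ) + 1) + 1) = 2 * (m : ℝ) + 3 := by ring
    rw [h']
    ring

/-- `E q x = x³ L(q x²)`. -/
def Ef (q x : ℝ) : ℝ := x ^ 3 * Lf (q * x ^ 2)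

lemma Ef_neg (q x : ℝ) : Ef q (-x) = - Ef q x := by
  simp only [Ef]; rw [show (-x) ^ 2 = x ^ 2 by ring]; ring

lemma Ath_hasDerivAt {x : ℝ} (hx : |x| < 1) : HasDerivAt Ath (1 / (1 - x ^ 2)) x := by
  rw [abs_lt] at hx
  have h1 : (1 + x) ≠ 0 := by linarith
  have h2 : (1 - x) ≠ 0 := by linarith
  have h3 : (1 - x ^ 2) ≠ 0 := by
    rw [show 1 - x ^ 2 = (1 + x) * (1 - x) by ring]; exact mul_ne_zero h1 h2
  have e1 := ((hasDerivAt_id x).const_add 1).log h1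
  have e2 := ((hasDerivAt_id x).const_sub 1).log h2
  refine ((e1.sub e2).const_mul (1/2)).congr_deriv ?_
  simp only [id]
  field_simp
  ring

lemma mul_sq_lt_abs {κ x : ℝ} (h : κ ^ 2 * x ^ 2 < 1) : |κ * x| < 1 := by
  rw [← sq_lt_one_iff_abs_lt_one]; nlinarith

lemma Ef_eq {κ x : ℝ} (hκ : 0 < κ) (h : κ ^ 2 * x ^ 2 < 1) :
    Ef (κ ^ 2) x = (Ath (κ * x) - κ * x) / κ ^ 3 := by
  rw [Ath_eq (mul_sq_lt_abs h), Ef, mul_pow κ x 2]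
  field_simp
  ring

lemma Ef_hasDerivAt {q x : ℝ} (hq : 0 ≤ q) (h : q * x ^ 2 < 1) :
    HasDerivAt (Ef q) (x ^ 2 / (1 - q * x ^ 2)) x := by
  rcases hq.eq_or_lt with rfl | hq
  · have : Ef 0 = fun x => x ^ 3 * (1 / 3) := by
      funext y; rw [Ef, zero_mul, Lf_zero]
    rw [this]
    refine ((hasDerivAt_pow 3 x).mul_const (1 / 3)).congr_deriv ?_
    norm_num
    ring
  · obtain ⟨κ, hκ, rfl⟩ : ∃ κ : ℝ, 0 < κ ∧ κ ^ 2 = q :=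
      ⟨Real.sqrt q, Real.sqrt_pos.2 hq, Real.sq_sqrt hq.le⟩
    have hd := Ath_hasDerivAt (mul_sq_lt_abs h)
    have h1 : HasDerivAt (fun y : ℝ => κ * y) κ x := by
      simpa using (hasDerivAt_id x).const_mul κ
    have h2 := ((hd.comp x h1).sub h1).div_const (κ ^ 3)
    have hev : ∀ᶠ y in 𝓝 x, κ ^ 2 * y ^ 2 < 1 :=
      (Continuous.tendsto (f := fun y : ℝ => κ ^ 2 * y ^ 2) (by fun_prop) x).eventually_lt_const h
    refine (h2.congr_of_eventuallyEq (hev.mono fun y hy => ?_)).congr_deriv ?_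
    · simpa using Ef_eq hκ hy
    · rw [mul_pow]
      have : 1 - κ ^ 2 * x ^ 2 ≠ 0 := by linarith
      field_simp
      ring

lemma Ef_analyticAt {q x : ℝ} (h : |q * x ^ 2| < 1) :
    AnalyticAt ℝ (fun p : ℝ × ℝ => Ef p.1 p.2) (q, x) := by
  unfold Ef
  have h1 : AnalyticAt ℝ (fun p : ℝ × ℝ => p.1 * p.2 ^ 2) (q, x) := analyticAt_fst.mul (analyticAt_snd.pow 2)
  have h2 : AnalyticAt ℝ (fun p : ℝ × ℝ => p.2 ^ 3) (q, x) := analyticAt_snd.pow 3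
  exact h2.mul (AnalyticAt.fun_comp (Lf_analyticAt h) h1)

/-- implicit function theorem, analytic, two real variables -/
lemma analytic_ift {G : ℝ × ℝ → ℝ} {q θ d : ℝ} (hG : AnalyticAt ℝ G (q, θ))
    (h0 : G (q, θ) = 0) (hd : HasDerivAt (fun t => G (q, t)) d θ) (hd0 : d ≠ 0) :
    ∃ ψ : ℝ → ℝ, AnalyticAt ℝ ψ q ∧ ψ q = θ ∧ ∀ᶠ x in 𝓝 q, G (x, ψ x) = 0 := by
  have hc : ContDiffAt ℝ ⊤ G (q, θ) := hG.contDiffAt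
  have hinv : (fderiv ℝ G (q, θ) ∘L .inr ℝ ℝ ℝ).IsInvertible := by
    have hf := hG.differentiableAt.hasFDerivAt
    have h2 : HasDerivAt (fun t => G (q, t)) (fderiv ℝ G (q, θ) (0, 1)) θ := by
      have h3 : HasDerivAt (fun t : ℝ => (q, t)) ((0 : ℝ), (1 : ℝ)) θ :=
        (hasDerivAt_const θ q).prodMk (hasDerivAt_id θ)
      exact hf.comp_hasDerivAt θ h3
    have h4 := h2.unique hd
    refine ⟨ContinuousLinearEquiv.unitsEquivAut ℝ (Units.mk0 d hd0), ?_⟩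
    ext
    simp [h4]
  refine ⟨hc.implicitFunction (by simp) hinv, ?_, ?_, ?_⟩
  · exact (hc.contDiffAt_implicitFunction (by simp) hinv).analyticAt
  · exact hc.implicitFunction_apply_self (by simp) hinv
  · have := hc.eventually_apply_implicitFunction (by simp) hinv
    rw [h0] at this
    exact this

/-! ### Part 2 -/

def Ff (β δ q θ : ℝ) : ℝ :=
  Real.sin (δ - β) * Ef q (Real.cos θ) - Real.sin δ * Ef q (Real.cos (θ - β)) +
    Real.sin β * Ef q (Real.cos (θ - δ))

def Tf (β δ q θ : ℝ) : ℝ :=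
  q * (Real.sin θ * Real.sin (θ - β) * Real.sin (θ - δ)) - (1 - q) * Real.sin (3 * θ - β - δ)

def Ns (β δ q θ : ℝ) : Prop :=
  q * Real.cos θ ^ 2 < 1 ∧ q * Real.cos (θ - β) ^ 2 < 1 ∧ q * Real.cos (θ - δ) ^ 2 < 1

def Df (β δ q θ : ℝ) : ℝ :=
  -(Real.sin β * Real.sin δ * Real.sin (δ - β)) * Tf β δ q θ /
    ((1 - q * Real.cos θ ^ 2) * (1 - q * Real.cos (θ - β) ^ 2) * (1 - q * Real.cos (θ - δ) ^ 2))

lemma q_mul_cos_lt {q : ℝ} (hq0 : 0 ≤ q) (hq : q < 1) (x : ℝ) : q * Real.cos x ^ 2 < 1 := by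
  have := Real.cos_sq_le_one x
  nlinarith [sq_nonneg (Real.cos x)]

lemma Ns_of_lt {β δ q θ : ℝ} (hq0 : 0 ≤ q) (hq : q < 1) : Ns β δ q θ :=
  ⟨q_mul_cos_lt hq0 hq _, q_mul_cos_lt hq0 hq _, q_mul_cos_lt hq0 hq _⟩

lemma Ff_hasDerivAt {β δ q θ : ℝ} (hq : 0 ≤ q) (h : Ns β δ q θ) :
    HasDerivAt (Ff β δ q) (Df β δ q θ) θ := by
  obtain ⟨h0, h1, h2⟩ := h
  have d0 := (Ef_hasDerivAt hq h0).comp θ (Real.hasDerivAt_cos θ)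
  have d1 := (Ef_hasDerivAt hq h1).comp θ
    ((Real.hasDerivAt_cos (θ - β)).comp θ ((hasDerivAt_id θ).sub_const β))
  have d2 := (Ef_hasDerivAt hq h2).comp θ
    ((Real.hasDerivAt_cos (θ - δ)).comp θ ((hasDerivAt_id θ).sub_const δ))
  have key := ((d0.const_mul (Real.sin (δ - β))).sub (d1.const_mul (Real.sin δ))).add
    (d2.const_mul (Real.sin β))
  refine key.congr_deriv ?_
  rw [Df, Tf]
  have e1 : δ - β = (θ - β) - (θ - δ) := by ring
  have e2 : Real.sin δ = Real.sin (θ - (θ - δ)) := by congr 1; ring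
  have e3 : Real.sin β = Real.sin (θ - (θ - β)) := by congr 1; ring
  have e4 : 3 * θ - β - δ = θ + (θ - β) + (θ - δ) := by ring
  rw [e1, e2, e3, e4]
  generalize θ - β = α1 at *
  generalize θ - δ = α2 at *
  have g0 : 1 - q * Real.cos θ ^ 2 ≠ 0 := by linarith
  have g1 : 1 - q * Real.cos α1 ^ 2 ≠ 0 := by linarith
  have g2 : 1 - q * Real.cos α2 ^ 2 ≠ 0 := by linarith
  have f0 : 1 - q * Real.cos θ ^ 2 = Real.sin θ ^ 2 + (1 - q) * Real.cos θ ^ 2 := by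
    linear_combination - Real.sin_sq_add_cos_sq θ
  have f1 : 1 - q * Real.cos α1 ^ 2 = Real.sin α1 ^ 2 + (1 - q) * Real.cos α1 ^ 2 := by
    linear_combination - Real.sin_sq_add_cos_sq α1
  have f2 : 1 - q * Real.cos α2 ^ 2 = Real.sin α2 ^ 2 + (1 - q) * Real.cos α2 ^ 2 := by
    linear_combination - Real.sin_sq_add_cos_sq α2
  simp only [Real.sin_sub, Real.sin_add, Real.cos_add]
  generalize 1 - q * Real.cos θ ^ 2 = D0 at *
  generalize 1 - q * Real.cos α1 ^ 2 = D1 at *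
  generalize 1 - q * Real.cos α2 ^ 2 = D2 at *
  field_simp
  subst f0 f1 f2
  ring

lemma cubic_four {c3 c2 c1 c0 x y z w : ℂ} (hx : c3 * x ^ 3 + c2 * x ^ 2 + c1 * x + c0 = 0)
    (hy : c3 * y ^ 3 + c2 * y ^ 2 + c1 * y + c0 = 0)
    (hz : c3 * z ^ 3 + c2 * z ^ 2 + c1 * z + c0 = 0)
    (hw : c3 * w ^ 3 + c2 * w ^ 2 + c1 * w + c0 = 0)
    (hxy : x ≠ y) (hxz : x ≠ z) (hxw : x ≠ w) (hyz : y ≠ z) (hyw : y ≠ w) (hzw : z ≠ w) :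
    c3 = 0 := by
  have a1 : c3 * (x ^ 2 + x * y + y ^ 2) + c2 * (x + y) + c1 = 0 := by
    apply mul_left_cancel₀ (sub_ne_zero.2 hxy); linear_combination hx - hy
  have a2 : c3 * (x ^ 2 + x * z + z ^ 2) + c2 * (x + z) + c1 = 0 := by
    apply mul_left_cancel₀ (sub_ne_zero.2 hxz); linear_combination hx - hz
  have a3 : c3 * (x ^ 2 + x * w + w ^ 2) + c2 * (x + w) + c1 = 0 := by
    apply mul_left_cancel₀ (sub_ne_zero.2 hxw); linear_combination hx - hw
  have b1 : c3 * (x + y + z) + c2 = 0 := by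
    apply mul_left_cancel₀ (sub_ne_zero.2 hyz); linear_combination a1 - a2
  have b2 : c3 * (x + y + w) + c2 = 0 := by
    apply mul_left_cancel₀ (sub_ne_zero.2 hyw); linear_combination a1 - a3
  apply mul_left_cancel₀ (sub_ne_zero.2 hzw); linear_combination b1 - b2

lemma Tf_cubic {β δ q θ : ℝ} (h : Tf β δ q θ = 0) :
    (4 - 3 * q : ℂ) * cexp (2 * I * θ) ^ 3 +
      (-(q * (1 + cexp (2 * I * β) + cexp (2 * I * δ)))) * cexp (2 * I * θ) ^ 2 +
      (q * (cexp (2 * I * β) + cexp (2 * I * δ) + cexp (2 * I * β) * cexp (2 * I * δ)))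
        * cexp (2 * I * θ) + (-((4 - 3 * q) * (cexp (2 * I * β) * cexp (2 * I * δ)))) = 0 := by
  have h' : ((Tf β δ q θ : ℝ) : ℂ) = 0 := by rw [h]; simp
  rw [Tf] at h'
  push_cast at h'
  rw [show (3 * (θ:ℂ) - β - δ) = θ + (θ - β) + (θ - δ) by ring] at h'
  simp only [Complex.sin] at h'
  have e2 : ∀ x : ℂ, cexp (2 * I * x) = cexp (x * I) ^ 2 := by
    intro x; rw [← Complex.exp_nat_mul]; congr 1; push_cast; ring
  rw [e2, e2, e2]
  have hs : ∀ x y : ℂ, cexp ((x - y) * I) = cexp (x * I) / cexp (y * I) := by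
    intro x y; rw [sub_mul, Complex.exp_sub]
  have ha : ∀ x y : ℂ, cexp ((x + y) * I) = cexp (x * I) * cexp (y * I) := by
    intro x y; rw [add_mul, Complex.exp_add]
  have hn : ∀ x : ℂ, cexp (-x * I) = (cexp (x * I))⁻¹ := by
    intro x; rw [neg_mul, Complex.exp_neg]
  simp only [hn, hs, ha] at h'
  have n1 := Complex.exp_ne_zero (θ * I)
  have n2 := Complex.exp_ne_zero (β * I)
  have n3 := Complex.exp_ne_zero (δ * I)
  generalize cexp (θ * I) = e at *
  generalize cexp (β * I) = b at *
  generalize cexp (δ * I) = d at *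
  have hI : I ^ 2 = -1 := Complex.I_sq
  field_simp at h'
  rw [hI] at h'
  apply mul_left_cancel₀ Complex.I_ne_zero
  linear_combination h'

lemma exp_two_ne {x y : ℝ} (h1 : x < y) (h2 : y < x + Real.pi) :
    cexp (2 * I * x) ≠ cexp (2 * I * y) := by
  intro h
  rw [Complex.exp_eq_exp_iff_exists_int] at h
  obtain ⟨n, hn⟩ := h
  have hn' : (x : ℂ) = y + n * Real.pi := by
    have : (2 * I : ℂ) ≠ 0 := by simp
    apply mul_left_cancel₀ this
    rw [hn]; ring
  have hr : x = y + n * Real.pi := by exact_mod_cast hn'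
  have hpi := Real.pi_pos
  have n1 : (n : ℝ) < 0 := by nlinarith
  have n2 : (-1 : ℝ) < n := by nlinarith
  have n1' : n < 0 := by exact_mod_cast n1
  have n2' : -1 < n := by exact_mod_cast n2
  omega

lemma Tf_four {β δ q x y z w : ℝ} (hq : q < 1) (hx : Tf β δ q x = 0)
    (hy : Tf β δ q y = 0) (hz : Tf β δ q z = 0) (hw : Tf β δ q w = 0)
    (hxy : x < y) (hyz : y < z) (hzw : z < w) (hwx : w < x + Real.pi) : False := by
  have := cubic_four (Tf_cubic hx) (Tf_cubic hy) (Tf_cubic hz) (Tf_cubic hw)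
    (exp_two_ne (by linarith) (by linarith)) (exp_two_ne (by linarith) (by linarith))
    (exp_two_ne (by linarith) (by linarith)) (exp_two_ne (by linarith) (by linarith))
    (exp_two_ne (by linarith) (by linarith)) (exp_two_ne (by linarith) (by linarith))
  have h : (4 - 3 * q : ℝ) = 0 := by exact_mod_cast this
  linarith

/-! ### Part 3 -/

lemma zero_pn {f : ℝ → ℝ} {p a b : ℝ} (hf : ContinuousOn f (Icc 0 p)) (h0 : 0 ≤ a) (hab : a < b)
    (hb : b ≤ p) (ha : 0 < f a) (hb' : f b < 0) : ∃ c, a < c ∧ c < b ∧ f c = 0 := by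
  have hf' : ContinuousOn f (Icc a b) := hf.mono (Icc_subset_Icc h0 hb)
  obtain ⟨c, hc, hc'⟩ := intermediate_value_Ioo' hab.le hf' ⟨hb', ha⟩
  exact ⟨c, hc.1, hc.2, hc'⟩

lemma zero_np {f : ℝ → ℝ} {p a b : ℝ} (hf : ContinuousOn f (Icc 0 p)) (h0 : 0 ≤ a) (hab : a < b)
    (hb : b ≤ p) (ha : f a < 0) (hb' : 0 < f b) : ∃ c, a < c ∧ c < b ∧ f c = 0 := by
  have hf' : ContinuousOn f (Icc a b) := hf.mono (Icc_subset_Icc h0 hb)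
  obtain ⟨c, hc, hc'⟩ := intermediate_value_Ioo hab.le hf' ⟨ha, hb'⟩
  exact ⟨c, hc.1, hc.2, hc'⟩

lemma three_zeros {f : ℝ → ℝ} {p : ℝ} (hp : 0 < p) (hf : ContinuousOn f (Icc 0 p))
    (h0 : 0 < f 0) (h1 : f p < 0)
    (O : ∀ z ∈ Ioo 0 p, ¬ ((∀ x ∈ Ioo 0 z, 0 ≤ f x) ∧ ∀ x ∈ Ioo z p, f x ≤ 0)) :
    ∃ a b c, 0 < a ∧ a < b ∧ b < c ∧ c < p ∧ f a = 0 ∧ f b = 0 ∧ f c = 0 := by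
  have O' : ∀ z ∈ Ioo 0 p, (∃ x, 0 < x ∧ x < z ∧ f x < 0) ∨ (∃ x, z < x ∧ x < p ∧ 0 < f x) := by
    intro z hz
    by_contra! hcon
    exact O z hz ⟨fun x hx => hcon.1 x hx.1 hx.2, fun x hx => hcon.2 x hx.1 hx.2⟩
  obtain ⟨z, z1, z2, hz⟩ := zero_pn hf le_rfl hp le_rfl h0 h1
  rcases O' z ⟨z1, z2⟩ with ⟨x, x1, x2, hx⟩ | ⟨x, x1, x2, hx⟩
  · obtain ⟨w, w1, w2, hw⟩ := zero_pn hf le_rfl x1 (by linarith) h0 hx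
    rcases O' w ⟨w1, by linarith⟩ with ⟨y, y1, y2, hy⟩ | ⟨y, y1, y2, hy⟩
    · obtain ⟨v, v1, v2, hv⟩ := zero_pn hf le_rfl y1 (by linarith) h0 hy
      exact ⟨v, w, z, v1, by linarith, by linarith, z2, hv, hw, hz⟩
    · rcases lt_trichotomy y z with hyz | hyz | hyz
      · rcases lt_trichotomy y x with hyx | hyx | hyx
        · obtain ⟨v, v1, v2, hv⟩ := zero_pn hf (by linarith) hyx (by linarith) hy hx
          exact ⟨w, v, z, w1, by linarith, by linarith, z2, hw, hv, hz⟩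
        · rw [hyx] at hy; linarith
        · obtain ⟨v, v1, v2, hv⟩ := zero_np hf (by linarith) hyx (by linarith) hx hy
          exact ⟨w, v, z, w1, by linarith, by linarith, z2, hw, hv, hz⟩
      · rw [hyz] at hy; linarith
      · obtain ⟨v, v1, v2, hv⟩ := zero_pn hf (by linarith) y2 le_rfl hy h1
        exact ⟨w, z, v, w1, by linarith, by linarith, v2, hw, hz, hv⟩
  · obtain ⟨w, w1, w2, hw⟩ := zero_pn hf (by linarith) x2 le_rfl hx h1
    rcases O' w ⟨by linarith, w2⟩ with ⟨y, y1, y2, hy⟩ | ⟨y, y1, y2, hy⟩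
    · rcases lt_trichotomy y z with hyz | hyz | hyz
      · obtain ⟨v, v1, v2, hv⟩ := zero_pn hf le_rfl y1 (by linarith) h0 hy
        exact ⟨v, z, w, v1, by linarith, by linarith, w2, hv, hz, hw⟩
      · rw [hyz] at hy; linarith
      · rcases lt_trichotomy y x with hyx | hyx | hyx
        · obtain ⟨v, v1, v2, hv⟩ := zero_np hf (by linarith) hyx (by linarith) hy hx
          exact ⟨z, v, w, z1, by linarith, by linarith, w2, hz, hv, hw⟩
        · rw [hyx] at hy; linarith
        · obtain ⟨v, v1, v2, hv⟩ := zero_pn hf (by linarith) hyx (by linarith) hx hy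
          exact ⟨z, v, w, z1, by linarith, by linarith, w2, hz, hv, hw⟩
    · obtain ⟨v, v1, v2, hv⟩ := zero_pn hf (by linarith) y2 le_rfl hy h1
      exact ⟨z, w, v, z1, by linarith, by linarith, v2, hz, hw, hv⟩

lemma Ff_continuous {β δ q : ℝ} (hq0 : 0 ≤ q) (hq : q < 1) : Continuous (Ff β δ q) :=
  continuous_iff_continuousAt.2 fun _ =>
    (Ff_hasDerivAt hq0 (Ns_of_lt hq0 hq)).continuousAt

lemma Ff_add_pi (β δ q θ : ℝ) : Ff β δ q (θ + Real.pi) = - Ff β δ q θ := by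
  unfold Ff
  rw [show θ + Real.pi - β = (θ - β) + Real.pi by ring,
    show θ + Real.pi - δ = (θ - δ) + Real.pi by ring]
  simp only [Real.cos_add_pi, Ef_neg]
  ring

lemma Ef_cos_continuous {q p : ℝ} (hq0 : 0 ≤ q) (hq : q < 1) :
    Continuous (fun θ => Ef q (Real.cos (θ - p))) := by
  refine continuous_iff_continuousAt.2 fun x => ?_
  have h1 := (Ef_hasDerivAt hq0 (q_mul_cos_lt hq0 hq (x - p))).continuousAt
  exact ContinuousAt.comp (f := fun θ : ℝ => Real.cos (θ - p)) h1 (by fun_prop)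

lemma Ef_int {q : ℝ} (hq0 : 0 ≤ q) (hq : q < 1) (p z : ℝ) :
    ∫ θ in (0:ℝ)..Real.pi, Ef q (Real.cos (θ - p)) * Real.sin (θ - z) =
      (∫ θ in (0:ℝ)..Real.pi, Ef q (Real.cos θ) * Real.cos θ) * Real.sin (p - z) := by
  set h : ℝ → ℝ := fun α => Ef q (Real.cos α) * Real.sin (α + (p - z)) with hh
  have hc0 : Continuous (fun θ => Ef q (Real.cos θ)) := by
    simpa using Ef_cos_continuous (p := 0) hq0 hq
  have hper : Function.Periodic h Real.pi := by
    intro α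
    simp only [hh]
    rw [show α + Real.pi + (p - z) = (α + (p - z)) + Real.pi by ring]
    simp only [Real.cos_add_pi, Real.sin_add_pi, Ef_neg]
    ring
  have e1 : ∫ θ in (0:ℝ)..Real.pi, Ef q (Real.cos (θ - p)) * Real.sin (θ - z) =
      ∫ θ in (0:ℝ)..Real.pi, h (θ - p) := by
    congr 1; funext θ; simp only [hh]; congr 2; ring
  rw [e1, intervalIntegral.integral_comp_sub_right h p]
  have e2 := hper.intervalIntegral_add_eq (0 - p) 0
  rw [zero_add, show 0 - p + Real.pi = Real.pi - p by ring] at e2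
  rw [e2]
  have e3 : ∫ θ in (0:ℝ)..Real.pi, Ef q (Real.cos θ) * Real.sin θ = 0 := by
    have := intervalIntegral.integral_comp_sub_left
      (fun θ => Ef q (Real.cos θ) * Real.sin θ) (a := 0) (b := Real.pi) Real.pi
    simp only [sub_self, sub_zero, Real.cos_pi_sub, Real.sin_pi_sub, Ef_neg, neg_mul,
      intervalIntegral.integral_neg] at this
    linarith
  have e4 : ∀ α, h α = (Ef q (Real.cos α) * Real.sin α) * Real.cos (p - z) +
      (Ef q (Real.cos α) * Real.cos α) * Real.sin (p - z) := by
    intro α; simp only [hh]; rw [Real.sin_add]; ring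
  simp only [e4]
  rw [intervalIntegral.integral_add, intervalIntegral.integral_mul_const,
    intervalIntegral.integral_mul_const, e3]
  · ring
  · exact Continuous.intervalIntegrable (by fun_prop) _ _
  · exact Continuous.intervalIntegrable (by fun_prop) _ _

lemma Ff_orth {β δ q : ℝ} (hq0 : 0 ≤ q) (hq : q < 1) (z : ℝ) :
    ∫ θ in (0:ℝ)..Real.pi, Ff β δ q θ * Real.sin (θ - z) = 0 := by
  have c0 := Ef_cos_continuous (p := 0) hq0 hq
  have cb := Ef_cos_continuous (p := β) hq0 hq
  have cd := Ef_cos_continuous (p := δ) hq0 hq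
  have e : ∀ θ, Ff β δ q θ * Real.sin (θ - z) =
      Real.sin (δ - β) * (Ef q (Real.cos (θ - 0)) * Real.sin (θ - z)) -
      Real.sin δ * (Ef q (Real.cos (θ - β)) * Real.sin (θ - z)) +
      Real.sin β * (Ef q (Real.cos (θ - δ)) * Real.sin (θ - z)) := by
    intro θ; rw [Ff, sub_zero]; ring
  simp only [e]
  rw [intervalIntegral.integral_add, intervalIntegral.integral_sub,
    intervalIntegral.integral_const_mul, intervalIntegral.integral_const_mul,
    intervalIntegral.integral_const_mul, Ef_int hq0 hq, Ef_int hq0 hq, Ef_int hq0 hq]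
  · simp only [Real.sin_sub, Real.sin_zero, Real.cos_zero]; ring
  all_goals exact Continuous.intervalIntegrable (by fun_prop) _ _

lemma Ef_le {q x : ℝ} (hq0 : 0 ≤ q) (hq : q < 1) (hx : 0 ≤ x) (hx1 : x ≤ 1) :
    Ef q x ≤ x * Ef q 1 := by
  unfold Ef
  have h1 : Lf (q * x ^ 2) ≤ Lf (q * 1 ^ 2) := by
    apply Lf_mono (by positivity)
    · gcongr
    · linarith
  have h2 : 0 < Lf (q * 1 ^ 2) := Lf_pos (by positivity) (by linarith)
  have h3 : x ^ 3 ≤ x := by nlinarith [mul_nonneg hx (by linarith : 0 ≤ 1 - x), mul_nonneg hx hx]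
  calc x ^ 3 * Lf (q * x ^ 2) ≤ x ^ 3 * Lf (q * 1 ^ 2) := by gcongr
    _ ≤ x * Lf (q * 1 ^ 2) := by gcongr
    _ = _ := by ring

lemma Ef_lt {q x : ℝ} (hq0 : 0 ≤ q) (hq : q < 1) (hx : 0 < x) (hx1 : x < 1) :
    Ef q x < x * Ef q 1 := by
  unfold Ef
  have h1 : Lf (q * x ^ 2) ≤ Lf (q * 1 ^ 2) := by
    apply Lf_mono (by positivity)
    · have : x ^ 2 ≤ 1 ^ 2 := by gcongr
      gcongr
    · linarith
  have h2 : 0 < Lf (q * 1 ^ 2) := Lf_pos (by positivity) (by linarith)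
  have h3 : x ^ 3 < x := by nlinarith [mul_pos hx (by linarith : 0 < 1 - x), mul_pos hx hx]
  calc x ^ 3 * Lf (q * x ^ 2) ≤ x ^ 3 * Lf (q * 1 ^ 2) := by gcongr
    _ < x * Lf (q * 1 ^ 2) := by gcongr
    _ = _ := by ring

lemma Ff_zero_pos {β δ q : ℝ} (hq0 : 0 ≤ q) (hq : q < 1) (hβ : 0 < β) (hβδ : β < δ)
    (hδ : δ < Real.pi) (h1 : β ≤ Real.pi / 2) (h2 : Real.pi / 2 ≤ δ) : 0 < Ff β δ q 0 := by
  have hpi := Real.pi_pos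
  have sb : 0 < Real.sin β := Real.sin_pos_of_pos_of_lt_pi hβ (by linarith)
  have sd : 0 < Real.sin δ := Real.sin_pos_of_pos_of_lt_pi (by linarith) hδ
  have cb : 0 ≤ Real.cos β := Real.cos_nonneg_of_neg_pi_div_two_le_of_le (by linarith) h1
  have cd : Real.cos δ ≤ 0 := Real.cos_nonpos_of_pi_div_two_le_of_le h2 (by linarith)
  have b1 := Real.sin_sq_add_cos_sq β
  have d1 := Real.sin_sq_add_cos_sq δ
  have cb1 : Real.cos β < 1 := by nlinarith
  have cd1 : -Real.cos δ < 1 := by nlinarith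
  have e : Ff β δ q 0 = Real.sin δ * (Real.cos β * Ef q 1 - Ef q (Real.cos β)) +
      Real.sin β * ((-Real.cos δ) * Ef q 1 - Ef q (-Real.cos δ)) := by
    rw [Ff, Ef_neg]
    simp only [zero_sub, Real.cos_neg, Real.cos_zero, Real.sin_sub]
    ring
  rw [e]
  have n1 := Ef_le hq0 hq cb cb1.le
  have n2 := Ef_le hq0 hq (by linarith : 0 ≤ - Real.cos δ) cd1.le
  rcases cb.eq_or_lt with h | h
  · have : 0 < -Real.cos δ := by
      rcases cd.eq_or_lt with h' | h'
      · exfalso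
        have s : Real.sin (δ - β) = 0 := by rw [Real.sin_sub, ← h, h']; ring
        have := Real.sin_pos_of_pos_of_lt_pi (by linarith : 0 < δ - β) (by linarith)
        linarith
      · linarith
    have n3 := Ef_lt hq0 hq this cd1
    have := mul_pos sb (sub_pos.2 n3)
    have := mul_nonneg sd.le (sub_nonneg.2 n1)
    linarith
  · have n3 := Ef_lt hq0 hq h cb1
    have := mul_pos sd (sub_pos.2 n3)
    have := mul_nonneg sb.le (sub_nonneg.2 n2)
    linarith

lemma Ff_O {β δ q : ℝ} (hq0 : 0 ≤ q) (hq : q < 1) (h0 : 0 < Ff β δ q 0) :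
    ∀ z ∈ Ioo 0 Real.pi, ¬ ((∀ x ∈ Ioo 0 z, 0 ≤ Ff β δ q x) ∧
      ∀ x ∈ Ioo z Real.pi, Ff β δ q x ≤ 0) := by
  rintro z ⟨z0, z1⟩ ⟨h1, h2⟩
  have hc := Ff_continuous (β := β) (δ := δ) hq0 hq
  have hpi := Real.pi_pos
  have key : ∫ θ in (0:ℝ)..Real.pi, Ff β δ q θ * Real.sin (θ - z) < ∫ θ in (0:ℝ)..Real.pi, (0:ℝ) := by
    apply intervalIntegral.integral_lt_integral_of_continuousOn_of_le_of_exists_lt hpi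
    · exact Continuous.continuousOn (by fun_prop)
    · exact continuousOn_const
    · rintro x ⟨x0, x1⟩
      rcases lt_trichotomy x z with h | h | h
      · have := Real.sin_nonpos_of_nonpos_of_neg_pi_le (by linarith : x - z ≤ 0) (by linarith)
        exact mul_nonpos_of_nonneg_of_nonpos (h1 x ⟨x0, h⟩) this
      · simp [h]
      · have s := Real.sin_nonneg_of_nonneg_of_le_pi (by linarith : 0 ≤ x - z) (by linarith)
        rcases x1.eq_or_lt with h' | h'
        · have : Ff β δ q x ≤ 0 := by
            rw [h', ← zero_add Real.pi, Ff_add_pi]; linarith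
          exact mul_nonpos_of_nonpos_of_nonneg this s
        · exact mul_nonpos_of_nonpos_of_nonneg (h2 x ⟨h, h'⟩) s
    · refine ⟨0, ⟨le_rfl, hpi.le⟩, ?_⟩
      have : Real.sin (0 - z) < 0 := Real.sin_neg_of_neg_of_neg_pi_lt (by linarith) (by linarith)
      exact mul_neg_of_pos_of_neg h0 this
  rw [Ff_orth hq0 hq] at key
  simp at key

/-! ### Part 4 -/

lemma Tf_of_Df {β δ q θ : ℝ} (hβ : 0 < β) (hβδ : β < δ) (hδ : δ < Real.pi) (hN : Ns β δ q θ)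
    (h : Df β δ q θ = 0) : Tf β δ q θ = 0 := by
  have sb : Real.sin β ≠ 0 := (Real.sin_pos_of_pos_of_lt_pi hβ (by linarith)).ne'
  have sd : Real.sin δ ≠ 0 := (Real.sin_pos_of_pos_of_lt_pi (by linarith) hδ).ne'
  have sbd : Real.sin (δ - β) ≠ 0 :=
    (Real.sin_pos_of_pos_of_lt_pi (by linarith : 0 < δ - β) (by linarith)).ne'
  obtain ⟨h0, h1, h2⟩ := hN
  have g0 : 1 - q * Real.cos θ ^ 2 ≠ 0 := by linarith
  have g1 : 1 - q * Real.cos (θ - β) ^ 2 ≠ 0 := by linarith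
  have g2 : 1 - q * Real.cos (θ - δ) ^ 2 ≠ 0 := by linarith
  rw [Df] at h
  simpa [g0, g1, g2, sb, sd, sbd] using h

lemma Ff_rolle {β δ q x y : ℝ} (hq0 : 0 ≤ q) (hβ : 0 < β) (hβδ : β < δ) (hδ : δ < Real.pi)
    (hN : ∀ t ∈ Icc x y, Ns β δ q t) (hxy : x < y) (hx : Ff β δ q x = 0) (hy : Ff β δ q y = 0) :
    ∃ c, x < c ∧ c < y ∧ Tf β δ q c = 0 := by
  have hc : ContinuousOn (Ff β δ q) (Icc x y) := fun t ht =>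
    (Ff_hasDerivAt hq0 (hN t ht)).continuousAt.continuousWithinAt
  obtain ⟨c, hc1, hc2⟩ := exists_hasDerivAt_eq_zero (f' := Df β δ q) hxy hc (by rw [hx, hy])
    (fun t ht => Ff_hasDerivAt hq0 (hN t (Ioo_subset_Icc_self ht)))
  exact ⟨c, hc1.1, hc1.2, Tf_of_Df hβ hβδ hδ (hN c (Ioo_subset_Icc_self hc1)) hc2⟩

lemma Ff_no_four {β δ q x y z w : ℝ} (hq0 : 0 ≤ q) (hq : q < 1) (hβ : 0 < β) (hβδ : β < δ)
    (hδ : δ < Real.pi) (hx : Ff β δ q x = 0) (hy : Ff β δ q y = 0) (hz : Ff β δ q z = 0)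
    (hw : Ff β δ q w = 0) (hxy : x < y) (hyz : y < z) (hzw : z < w) (hwx : w < x + Real.pi) :
    False := by
  have R : ∀ x y, x < y → Ff β δ q x = 0 → Ff β δ q y = 0 → ∃ c, x < c ∧ c < y ∧ Tf β δ q c = 0 :=
    fun x y => Ff_rolle hq0 hβ hβδ hδ (fun _ _ => Ns_of_lt hq0 hq)
  obtain ⟨a, a1, a2, ha⟩ := R x y hxy hx hy
  obtain ⟨b, b1, b2, hb⟩ := R y z hyz hy hz
  obtain ⟨c, c1, c2, hc⟩ := R z w hzw hz hw
  obtain ⟨d, d1, d2, hd⟩ := R w (x + Real.pi) hwx hw (by rw [Ff_add_pi, hx, neg_zero])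
  exact Tf_four hq ha hb hc hd (by linarith) (by linarith) (by linarith) (by linarith)

/-- The structure of the zero set at a given level. -/
def ZS (β δ q a b c : ℝ) : Prop :=
  0 < a ∧ a < b ∧ b < c ∧ c < Real.pi ∧ (Ns β δ q a ∧ Ns β δ q b ∧ Ns β δ q c) ∧
    (Ff β δ q a = 0 ∧ Ff β δ q b = 0 ∧ Ff β δ q c = 0) ∧
    (Df β δ q a ≠ 0 ∧ Df β δ q b ≠ 0 ∧ Df β δ q c ≠ 0) ∧
    ∀ θ, 0 ≤ θ → θ < Real.pi → Ns β δ q θ → Ff β δ q θ = 0 → θ = a ∨ θ = b ∨ θ = c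

lemma ZS_lt {β δ q : ℝ} (hq0 : 0 ≤ q) (hq : q < 1) (hβ : 0 < β) (hβδ : β < δ)
    (hδ : δ < Real.pi) (h1 : β ≤ Real.pi / 2) (h2 : Real.pi / 2 ≤ δ) :
    ∃ a b c, ZS β δ q a b c := by
  have hpos := Ff_zero_pos hq0 hq hβ hβδ hδ h1 h2
  have hneg : Ff β δ q Real.pi < 0 := by
    rw [← zero_add Real.pi, Ff_add_pi]; linarith
  obtain ⟨a, b, c, a0, ab, bc, cp, ha, hb, hc⟩ := three_zeros Real.pi_pos
    (Ff_continuous hq0 hq).continuousOn hpos hneg (Ff_O hq0 hq hpos)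
  have N : ∀ θ, Ns β δ q θ := fun _ => Ns_of_lt hq0 hq
  have R : ∀ x y, x < y → Ff β δ q x = 0 → Ff β δ q y = 0 → ∃ c, x < c ∧ c < y ∧ Tf β δ q c = 0 :=
    fun x y => Ff_rolle hq0 hβ hβδ hδ (fun _ _ => Ns_of_lt hq0 hq)
  obtain ⟨u, u1, u2, hu⟩ := R a b ab ha hb
  obtain ⟨v, v1, v2, hv⟩ := R b c bc hb hc
  obtain ⟨w, w1, w2, hw⟩ := R c (a + Real.pi) (by linarith) hc (by rw [Ff_add_pi, ha, neg_zero])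
  refine ⟨a, b, c, a0, ab, bc, cp, ⟨N _, N _, N _⟩, ⟨ha, hb, hc⟩, ⟨fun h => ?_, fun h => ?_, fun h => ?_⟩, ?_⟩
  · exact Tf_four hq (Tf_of_Df hβ hβδ hδ (N _) h) hu hv hw (by linarith) (by linarith)
      (by linarith) (by linarith)
  · exact Tf_four hq hu (Tf_of_Df hβ hβδ hδ (N _) h) hv hw (by linarith) (by linarith)
      (by linarith) (by linarith)
  · exact Tf_four hq hu hv (Tf_of_Df hβ hβδ hδ (N _) h) hw (by linarith) (by linarith)
      (by linarith) (by linarith)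
  · intro θ t0 tp _ ht
    have F := fun x y z w => Ff_no_four (x := x) (y := y) (z := z) (w := w) hq0 hq hβ hβδ hδ
    rcases lt_trichotomy θ a with h | h | h
    · exact (F θ a b c ht ha hb hc (by linarith) (by linarith) (by linarith) (by linarith)).elim
    · exact Or.inl h
    rcases lt_trichotomy θ b with h' | h' | h'
    · exact (F a θ b c ha ht hb hc (by linarith) (by linarith) (by linarith) (by linarith)).elim
    · exact Or.inr (Or.inl h')
    rcases lt_trichotomy θ c with h'' | h'' | h''
    · exact (F a b θ c ha hb ht hc (by linarith) (by linarith) (by linarith) (by linarith)).elim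
    · exact Or.inr (Or.inr h'')
    · exact (F a b c θ ha hb hc ht (by linarith) (by linarith) (by linarith) (by linarith)).elim

lemma cos_sq_lt_iff (x : ℝ) : 1 * Real.cos x ^ 2 < 1 ↔ Real.sin x ≠ 0 := by
  have := Real.sin_sq_add_cos_sq x
  constructor
  · intro h h'; rw [h'] at this; linarith
  · intro h; have : 0 < Real.sin x ^ 2 := by positivity
    linarith

lemma Ef_one_tendsto : Tendsto (fun θ => Ef 1 (Real.cos θ)) (𝓝[≠] 0) atTop := by
  have hpi := Real.pi_pos
  have hev : ∀ᶠ θ in 𝓝[≠] (0:ℝ), Real.sin θ ≠ 0 ∧ 0 < 1 - Real.cos θ := by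
    have h1 : Ioo (-Real.pi) Real.pi ∈ 𝓝 (0:ℝ) := Ioo_mem_nhds (by linarith) hpi
    filter_upwards [mem_nhdsWithin_of_mem_nhds h1, self_mem_nhdsWithin] with θ h2 h3
    have hs : Real.sin θ ≠ 0 := by
      rcases lt_or_gt_of_ne (show θ ≠ 0 from h3) with h | h
      · exact (Real.sin_neg_of_neg_of_neg_pi_lt h h2.1).ne
      · exact (Real.sin_pos_of_pos_of_lt_pi h h2.2).ne'
    refine ⟨hs, ?_⟩
    have := (cos_sq_lt_iff θ).2 hs
    nlinarith
  have hlog : Tendsto (fun θ => -Real.log (1 - Real.cos θ)) (𝓝[≠] 0) atTop := by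
    apply tendsto_neg_atBot_atTop.comp
    apply Real.tendsto_log_nhdsGT_zero.comp
    apply tendsto_nhdsWithin_iff.2
    refine ⟨?_, hev.mono fun θ h => h.2⟩
    have : Tendsto (fun θ : ℝ => 1 - Real.cos θ) (𝓝 0) (𝓝 (1 - Real.cos 0)) :=
      Continuous.tendsto (by fun_prop) _
    rw [Real.cos_zero, sub_self] at this
    exact this.mono_left nhdsWithin_le_nhds
  have hrest : Tendsto (fun θ => Real.log (1 + Real.cos θ) - 2 * Real.cos θ) (𝓝[≠] 0)
      (𝓝 (Real.log (1 + Real.cos 0) - 2 * Real.cos 0)) := by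
    have : ContinuousAt (fun θ => Real.log (1 + Real.cos θ) - 2 * Real.cos θ) 0 := by
      have : ContinuousAt (fun θ => Real.log (1 + Real.cos θ)) 0 := by
        apply ContinuousAt.log (by fun_prop); simp
      fun_prop
    exact this.tendsto.mono_left nhdsWithin_le_nhds
  have := (hlog.atTop_add hrest).const_mul_atTop (by norm_num : (0:ℝ) < 1 / 2)
  refine this.congr' (hev.mono fun θ h => ?_)
  have h2 := (cos_sq_lt_iff θ).2 h.1
  have h3 := Ef_eq (κ := 1) (x := Real.cos θ) one_pos (by simpa using h2)
  rw [one_pow] at h3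
  show _ = Ef 1 (Real.cos θ)
  rw [h3, Ath]
  simp only [one_mul, one_pow]
  ring

lemma Ef_one_tendsto' (p : ℝ) : Tendsto (fun θ => Ef 1 (Real.cos (θ - p))) (𝓝[≠] p) atTop := by
  refine Ef_one_tendsto.comp (f := fun θ => θ - p) ?_
  apply tendsto_nhdsWithin_iff.2
  constructor
  · have : Tendsto (fun θ : ℝ => θ - p) (𝓝 p) (𝓝 (p - p)) := Continuous.tendsto (by fun_prop) _
    rw [sub_self] at this
    exact this.mono_left nhdsWithin_le_nhds
  · filter_upwards [self_mem_nhdsWithin] with θ h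
    exact sub_ne_zero.2 h

lemma Ef_one_cont {p x : ℝ} (h : Real.sin (x - p) ≠ 0) :
    ContinuousAt (fun θ => Ef 1 (Real.cos (θ - p))) x := by
  have h1 := (Ef_hasDerivAt zero_le_one ((cos_sq_lt_iff (x - p)).2 h)).continuousAt
  exact ContinuousAt.comp (f := fun θ : ℝ => Real.cos (θ - p)) h1 (by fun_prop)

lemma Ff_one_tendsto_zero {β δ : ℝ} (hβ : 0 < β) (hβδ : β < δ) (hδ : δ < Real.pi) :
    Tendsto (Ff β δ 1) (𝓝[≠] 0) atTop := by
  have sb := Real.sin_pos_of_pos_of_lt_pi hβ (by linarith)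
  have sd := Real.sin_pos_of_pos_of_lt_pi (by linarith : 0 < δ) hδ
  have sbd := Real.sin_pos_of_pos_of_lt_pi (by linarith : 0 < δ - β) (by linarith)
  have c1 : ContinuousAt (fun θ => Ef 1 (Real.cos (θ - β))) 0 :=
    Ef_one_cont (by rw [zero_sub, Real.sin_neg]; linarith)
  have c2 : ContinuousAt (fun θ => Ef 1 (Real.cos (θ - δ))) 0 :=
    Ef_one_cont (by rw [zero_sub, Real.sin_neg]; linarith)
  have c3 : ContinuousAt (fun θ => - Real.sin δ * Ef 1 (Real.cos (θ - β)) +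
    Real.sin β * Ef 1 (Real.cos (θ - δ))) 0 := by fun_prop
  have := (Ef_one_tendsto.const_mul_atTop sbd).atTop_add (c3.tendsto.mono_left nhdsWithin_le_nhds)
  refine this.congr fun θ => ?_
  rw [Ff]; ring

lemma Ff_one_tendsto_β {β δ : ℝ} (hβ : 0 < β) (hβδ : β < δ) (hδ : δ < Real.pi) :
    Tendsto (Ff β δ 1) (𝓝[≠] β) atBot := by
  have sb := Real.sin_pos_of_pos_of_lt_pi hβ (by linarith)
  have sd := Real.sin_pos_of_pos_of_lt_pi (by linarith : 0 < δ) hδ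
  have sbd := Real.sin_pos_of_pos_of_lt_pi (by linarith : 0 < δ - β) (by linarith)
  have c1 : ContinuousAt (fun θ => Ef 1 (Real.cos (θ - 0))) β :=
    Ef_one_cont (by rw [sub_zero]; linarith)
  have c2 : ContinuousAt (fun θ => Ef 1 (Real.cos (θ - δ))) β :=
    Ef_one_cont (by rw [← neg_sub, Real.sin_neg]; linarith)
  have c3 : ContinuousAt (fun θ => Real.sin (δ - β) * Ef 1 (Real.cos (θ - 0)) +
    Real.sin β * Ef 1 (Real.cos (θ - δ))) β := by fun_prop
  have := ((Ef_one_tendsto' β).const_mul_atTop_of_neg (by linarith : - Real.sin δ < 0)).atBot_add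
    (c3.tendsto.mono_left nhdsWithin_le_nhds)
  refine this.congr fun θ => ?_
  rw [Ff, sub_zero]; ring

lemma Ff_one_tendsto_δ {β δ : ℝ} (hβ : 0 < β) (hβδ : β < δ) (hδ : δ < Real.pi) :
    Tendsto (Ff β δ 1) (𝓝[≠] δ) atTop := by
  have sb := Real.sin_pos_of_pos_of_lt_pi hβ (by linarith)
  have sd := Real.sin_pos_of_pos_of_lt_pi (by linarith : 0 < δ) hδ
  have sbd := Real.sin_pos_of_pos_of_lt_pi (by linarith : 0 < δ - β) (by linarith)
  have c1 : ContinuousAt (fun θ => Ef 1 (Real.cos (θ - 0))) δ :=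
    Ef_one_cont (by rw [sub_zero]; linarith)
  have c2 : ContinuousAt (fun θ => Ef 1 (Real.cos (θ - β))) δ :=
    Ef_one_cont (by linarith)
  have c3 : ContinuousAt (fun θ => Real.sin (δ - β) * Ef 1 (Real.cos (θ - 0)) -
    Real.sin δ * Ef 1 (Real.cos (θ - β))) δ := by fun_prop
  have := ((Ef_one_tendsto' δ).const_mul_atTop sb).atTop_add
    (c3.tendsto.mono_left nhdsWithin_le_nhds)
  refine this.congr fun θ => ?_
  rw [Ff, sub_zero]; ring

lemma Ff_one_tendsto_pi {β δ : ℝ} (hβ : 0 < β) (hβδ : β < δ) (hδ : δ < Real.pi) :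
    Tendsto (Ff β δ 1) (𝓝[≠] Real.pi) atBot := by
  have h := tendsto_neg_atTop_atBot.comp (Ff_one_tendsto_zero hβ hβδ hδ)
  have h2 : Tendsto (fun θ => θ - Real.pi) (𝓝[≠] Real.pi) (𝓝[≠] 0) := by
    apply tendsto_nhdsWithin_iff.2
    constructor
    · have : Tendsto (fun θ : ℝ => θ - Real.pi) (𝓝 Real.pi) (𝓝 (Real.pi - Real.pi)) :=
        Continuous.tendsto (by fun_prop) _
      rw [sub_self] at this
      exact this.mono_left nhdsWithin_le_nhds
    · filter_upwards [self_mem_nhdsWithin] with θ h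
      exact sub_ne_zero.2 h
  refine (h.comp h2).congr fun θ => ?_
  simp only [Function.comp]
  rw [← Ff_add_pi, sub_add_cancel]

lemma zero_Ioo {f : ℝ → ℝ} {l r : ℝ} (hlr : l < r) (hf : ContinuousOn f (Ioo l r))
    (hl : Tendsto f (𝓝[≠] l) atTop) (hr : Tendsto f (𝓝[≠] r) atBot) :
    ∃ c, l < c ∧ c < r ∧ f c = 0 := by
  have l1 : ∀ᶠ x in 𝓝[>] l, 0 < f x ∧ x ∈ Ioo l ((l + r) / 2) :=
    ((hl.mono_left (nhdsWithin_mono _ fun x hx => ne_of_gt hx)).eventually_gt_atTop 0).and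
      (Ioo_mem_nhdsGT (by linarith))
  have r1 : ∀ᶠ x in 𝓝[<] r, f x < 0 ∧ x ∈ Ioo ((l + r) / 2) r :=
    ((hr.mono_left (nhdsWithin_mono _ fun x hx => ne_of_lt hx)).eventually_lt_atBot 0).and
      (Ioo_mem_nhdsLT (by linarith))
  obtain ⟨x, hx, hx1, hx2⟩ := l1.exists
  obtain ⟨y, hy, hy1, hy2⟩ := r1.exists
  obtain ⟨c, hc, hc'⟩ := intermediate_value_Ioo' (by linarith : x ≤ y)
    (hf.mono fun t ht => ⟨by linarith [ht.1], by linarith [ht.2]⟩) ⟨hy, hx⟩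
  exact ⟨c, by linarith [hc.1], by linarith [hc.2], hc'⟩

lemma Ns_one {β δ θ : ℝ} (h0 : Real.sin θ ≠ 0) (h1 : Real.sin (θ - β) ≠ 0)
    (h2 : Real.sin (θ - δ) ≠ 0) : Ns β δ 1 θ :=
  ⟨(cos_sq_lt_iff _).2 h0, (cos_sq_lt_iff _).2 h1, (cos_sq_lt_iff _).2 h2⟩

lemma Df_one {β δ θ : ℝ} (hβ : 0 < β) (hβδ : β < δ) (hδ : δ < Real.pi) (hN : Ns β δ 1 θ) :
    Tf β δ 1 θ ≠ 0 := by
  obtain ⟨h0, h1, h2⟩ := hN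
  rw [cos_sq_lt_iff] at h0 h1 h2
  rw [Tf]
  simp [h0, h1, h2]

lemma sin_ne_of {x : ℝ} (h1 : -Real.pi < x) (h2 : x < Real.pi) (h : x ≠ 0) : Real.sin x ≠ 0 := by
  rcases lt_or_gt_of_ne h with h | h
  · exact (Real.sin_neg_of_neg_of_neg_pi_lt h h1).ne
  · exact (Real.sin_pos_of_pos_of_lt_pi h h2).ne'

lemma Ns_one_of {β δ θ : ℝ} (hβ : 0 < β) (hβδ : β < δ) (hδ : δ < Real.pi) (h0 : 0 < θ)
    (hp : θ < Real.pi) (h1 : θ ≠ β) (h2 : θ ≠ δ) : Ns β δ 1 θ :=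
  Ns_one (sin_ne_of (by linarith) hp h0.ne')
    (sin_ne_of (by linarith) (by linarith) (sub_ne_zero.2 h1))
    (sin_ne_of (by linarith) (by linarith) (sub_ne_zero.2 h2))

/-- the three zeros at level one -/
lemma zeros_one {β δ : ℝ} (hβ : 0 < β) (hβδ : β < δ) (hδ : δ < Real.pi) :
    ∃ a b c, 0 < a ∧ a < β ∧ β < b ∧ b < δ ∧ δ < c ∧ c < Real.pi ∧
      Ff β δ 1 a = 0 ∧ Ff β δ 1 b = 0 ∧ Ff β δ 1 c = 0 := by
  have C : ∀ θ, 0 < θ → θ < Real.pi → θ ≠ β → θ ≠ δ → ContinuousAt (Ff β δ 1) θ :=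
    fun θ h1 h2 h3 h4 =>
      (Ff_hasDerivAt zero_le_one (Ns_one_of hβ hβδ hδ h1 h2 h3 h4)).continuousAt
  obtain ⟨a, a1, a2, ha⟩ := zero_Ioo (f := Ff β δ 1) hβ (fun t ht => (C t ht.1 (by linarith [ht.2])
    ht.2.ne (by linarith [ht.2])).continuousWithinAt) (Ff_one_tendsto_zero hβ hβδ hδ)
    (Ff_one_tendsto_β hβ hβδ hδ)
  obtain ⟨c, c1, c2, hc⟩ := zero_Ioo (f := Ff β δ 1) hδ (fun t ht => (C t (by linarith [ht.1]) ht.2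
    (by linarith [ht.1]) ht.1.ne').continuousWithinAt) (Ff_one_tendsto_δ hβ hβδ hδ)
    (Ff_one_tendsto_pi hβ hβδ hδ)
  obtain ⟨b, b1, b2, hb⟩ := zero_Ioo (f := fun t => -Ff β δ 1 t) hβδ
    (fun t ht => (C t (by linarith [ht.1]) (by linarith [ht.2])
      ht.1.ne' ht.2.ne).neg.continuousWithinAt)
    (tendsto_neg_atBot_atTop.comp (Ff_one_tendsto_β hβ hβδ hδ))
    (tendsto_neg_atTop_atBot.comp (Ff_one_tendsto_δ hβ hβδ hδ))
  exact ⟨a, b, c, a1, a2, b1, b2, c1, c2, ha, by simpa using hb, hc⟩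

lemma ZS_one {β δ : ℝ} (hβ : 0 < β) (hβδ : β < δ) (hδ : δ < Real.pi) :
    ∃ a b c, ZS β δ 1 a b c := by
  obtain ⟨a, b, c, a1, a2, b1, b2, c1, c2, ha, hb, hc⟩ := zeros_one hβ hβδ hδ
  have N : ∀ θ, 0 < θ → θ < Real.pi → θ ≠ β → θ ≠ δ → Ns β δ 1 θ :=
    fun θ => Ns_one_of hβ hβδ hδ
  have Na := N a a1 (by linarith) a2.ne (by linarith)
  have Nb := N b (by linarith) (by linarith) b1.ne' b2.ne
  have Nc := N c (by linarith) (by linarith) (by linarith) c1.ne'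
  have D : ∀ θ, Ns β δ 1 θ → Df β δ 1 θ ≠ 0 := fun θ h h' =>
    Df_one hβ hβδ hδ h (Tf_of_Df hβ hβδ hδ h h')
  have U : ∀ x y, Ff β δ 1 x = 0 → Ff β δ 1 y = 0 →
      (∀ t ∈ Icc x y, Ns β δ 1 t) → ¬ x < y := by
    intro x y hx hy hN hxy
    obtain ⟨t, t1, t2, ht⟩ := Ff_rolle zero_le_one hβ hβδ hδ hN hxy hx hy
    exact Df_one hβ hβδ hδ (hN t ⟨t1.le, t2.le⟩) ht
  refine ⟨a, b, c, a1, by linarith, by linarith, c2, ⟨Na, Nb, Nc⟩, ⟨ha, hb, hc⟩,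
    ⟨D a Na, D b Nb, D c Nc⟩, ?_⟩
  intro θ t0 tp hN ht
  have s0 := (cos_sq_lt_iff _).1 hN.1
  have s1 := (cos_sq_lt_iff _).1 hN.2.1
  have s2 := (cos_sq_lt_iff _).1 hN.2.2
  have t0' : 0 < θ := lt_of_le_of_ne t0 (by rintro rfl; simp at s0)
  have t1 : θ ≠ β := by rintro rfl; simp at s1
  have t2 : θ ≠ δ := by rintro rfl; simp at s2
  rcases lt_or_gt_of_ne t1 with h | h
  · left
    rcases lt_trichotomy θ a with h' | h' | h'
    · exact (U θ a ht ha (fun t ht => N t (by linarith [ht.1]) (by linarith [ht.2])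
        (by linarith [ht.2]) (by linarith [ht.2])) h').elim
    · exact h'
    · exact (U a θ ha ht (fun t ht => N t (by linarith [ht.1]) (by linarith [ht.2])
        (by linarith [ht.2]) (by linarith [ht.2])) h').elim
  rcases lt_or_gt_of_ne t2 with k | k
  · right; left
    rcases lt_trichotomy θ b with h' | h' | h'
    · exact (U θ b ht hb (fun t ht => N t (by linarith [ht.1]) (by linarith [ht.2])
        (by linarith [ht.1]) (by linarith [ht.2])) h').elim
    · exact h'
    · exact (U b θ hb ht (fun t ht => N t (by linarith [ht.1]) (by linarith [ht.2])
        (by linarith [ht.1]) (by linarith [ht.2])) h').elim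
  · right; right
    rcases lt_trichotomy θ c with h' | h' | h'
    · exact (U θ c ht hc (fun t ht => N t (by linarith [ht.1]) (by linarith [ht.2])
        (by linarith [ht.1]) (by linarith [ht.1])) h').elim
    · exact h'
    · exact (U c θ hc ht (fun t ht => N t (by linarith [ht.1]) (by linarith [ht.2])
        (by linarith [ht.1]) (by linarith [ht.1])) h').elim

/-! ### Part 5 -/

lemma analytic_extend {a : ℝ → ℝ} (h : ∀ q0 ∈ Icc (0:ℝ) 1, ∃ ψ : ℝ → ℝ, AnalyticAt ℝ ψ q0 ∧
    ∀ᶠ q in 𝓝 q0, q ∈ Icc (0:ℝ) 1 → a q = ψ q) :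
    ∃ f : ℝ → ℝ, AnalyticOnNhd ℝ f (Icc 0 1) ∧ ∀ q ∈ Icc (0:ℝ) 1, f q = a q := by
  obtain ⟨ψ0, h0, e0⟩ := h 0 ⟨le_rfl, zero_le_one⟩
  obtain ⟨ψ1, h1, e1⟩ := h 1 ⟨zero_le_one, le_rfl⟩
  refine ⟨fun q => if q < 0 then ψ0 q else if 1 < q then ψ1 q else a q, ?_, ?_⟩
  · intro q0 hq0
    obtain ⟨ψ, hψ, e⟩ := h q0 hq0
    rcases hq0.1.eq_or_lt with hz | hz
    · subst hz
      refine h0.congr ?_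
      filter_upwards [e0, Iio_mem_nhds (zero_lt_one' ℝ)] with q hq hq1
      have hq1' : q < 1 := hq1
      by_cases hn : q < 0
      · simp [hn]
      · simp only [hn, if_false, not_lt.2 hq1'.le]
        exact (hq ⟨not_lt.1 hn, hq1'.le⟩).symm
    rcases hq0.2.eq_or_lt with ho | ho
    · subst ho
      refine h1.congr ?_
      filter_upwards [e1, Ioi_mem_nhds (zero_lt_one' ℝ)] with q hq hq1
      have hq1' : 0 < q := hq1
      simp only [not_lt.2 hq1'.le, if_false]
      by_cases hn : 1 < q
      · simp [hn]
      · simp only [hn, if_false]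
        exact (hq ⟨hq1'.le, not_lt.1 hn⟩).symm
    · refine hψ.congr ?_
      filter_upwards [e, Ioo_mem_nhds hz ho] with q hq hq1
      simp only [not_lt.2 hq1.1.le, not_lt.2 hq1.2.le, if_false]
      exact (hq ⟨hq1.1.le, hq1.2.le⟩).symm
  · intro q hq
    simp only [not_lt.2 hq.1, not_lt.2 hq.2, if_false]

lemma cos_sub_analyticAt (p : ℝ) (x : ℝ × ℝ) :
    AnalyticAt ℝ (fun y : ℝ × ℝ => Real.cos (y.2 - p)) x := by
  have h : AnalyticAt ℝ (fun t : ℝ => Real.cos t) (x.2 - p) := by fun_prop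
  have h2 : AnalyticAt ℝ (fun y : ℝ × ℝ => y.2 - p) x := analyticAt_snd.sub analyticAt_const
  exact AnalyticAt.fun_comp h h2

lemma Ef_cos_analyticAt {p q θ : ℝ} (hq : 0 ≤ q) (h : q * Real.cos (θ - p) ^ 2 < 1) :
    AnalyticAt ℝ (fun y : ℝ × ℝ => Ef y.1 (Real.cos (y.2 - p))) (q, θ) := by
  have h1 : AnalyticAt ℝ (fun y : ℝ × ℝ => (y.1, Real.cos (y.2 - p))) (q, θ) :=
    analyticAt_fst.prod (cos_sub_analyticAt p _)
  have h2 : AnalyticAt ℝ (fun p : ℝ × ℝ => Ef p.1 p.2) (q, Real.cos (θ - p)) :=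
    Ef_analyticAt (by rw [abs_of_nonneg (by positivity)]; exact h)
  exact AnalyticAt.comp' (g := fun p : ℝ × ℝ => Ef p.1 p.2)
    (f := fun y : ℝ × ℝ => (y.1, Real.cos (y.2 - p))) h2 h1

lemma Ff_analyticAt {β δ q θ : ℝ} (hq : 0 ≤ q) (h : Ns β δ q θ) :
    AnalyticAt ℝ (fun y : ℝ × ℝ => Ff β δ y.1 y.2) (q, θ) := by
  obtain ⟨h0, h1, h2⟩ := h
  have e0 := Ef_cos_analyticAt (p := 0) hq (by simpa using h0)
  have e1 := Ef_cos_analyticAt (p := β) hq h1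
  have e2 := Ef_cos_analyticAt (p := δ) hq h2
  simp only [sub_zero] at e0
  unfold Ff
  exact ((analyticAt_const.mul e0).sub (analyticAt_const.mul e1)).add (analyticAt_const.mul e2)

lemma Ns_eventually {β δ q : ℝ} {ψ : ℝ → ℝ} (hc : ContinuousAt ψ q) (h : Ns β δ q (ψ q)) :
    ∀ᶠ x in 𝓝 q, Ns β δ x (ψ x) := by
  obtain ⟨h0, h1, h2⟩ := h
  have c : ∀ p, ContinuousAt (fun x => x * Real.cos (ψ x - p) ^ 2) q := fun p => by fun_prop
  have c0 := (c 0).tendsto.eventually_lt_const (by simpa using h0)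
  filter_upwards [c0, (c β).tendsto.eventually_lt_const h1,
    (c δ).tendsto.eventually_lt_const h2] with x h3 h4 h5
  exact ⟨by simpa using h3, h4, h5⟩

lemma branch {β δ q θ : ℝ} (hq : 0 ≤ q) (h : Ns β δ q θ) (h0 : Ff β δ q θ = 0)
    (hd : Df β δ q θ ≠ 0) : ∃ ψ : ℝ → ℝ, AnalyticAt ℝ ψ q ∧ ψ q = θ ∧
      ∀ᶠ x in 𝓝 q, Ns β δ x (ψ x) ∧ Ff β δ x (ψ x) = 0 := by
  obtain ⟨ψ, h1, h2, h3⟩ := analytic_ift (Ff_analyticAt hq h) h0 (Ff_hasDerivAt hq h) hd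
  exact ⟨ψ, h1, h2, (Ns_eventually h1.continuousAt (by rw [h2]; exact h)).and h3⟩

lemma sorted_eq {a b c x y z : ℝ} (hxy : x < y) (hyz : y < z) (hab : a < b) (hbc : b < c)
    (hx : x = a ∨ x = b ∨ x = c) (hy : y = a ∨ y = b ∨ y = c) (hz : z = a ∨ z = b ∨ z = c) :
    a = x ∧ b = y ∧ c = z := by
  rcases hx with rfl | rfl | rfl <;> rcases hy with rfl | rfl | rfl <;>
    rcases hz with rfl | rfl | rfl <;> first | exact ⟨rfl, rfl, rfl⟩ | (exfalso; linarith)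

def Good (β δ : ℝ) : Prop := ∃ ϑ : Fin 3 → ℝ → ℝ, (∀ k, AnalyticOnNhd ℝ (ϑ k) (Icc 0 1)) ∧
  ∀ q ∈ Icc (0:ℝ) 1, (∀ k, Ns β δ q (ϑ k q) ∧ Ff β δ q (ϑ k q) = 0) ∧
    ∀ θ, Ns β δ q θ → Ff β δ q θ = 0 → ∃ k, ∃ n : ℤ, θ = ϑ k q + n * Real.pi

lemma zero_periodic (β δ q : ℝ) :
    Function.Periodic (fun θ => Ns β δ q θ ∧ Ff β δ q θ = 0) Real.pi := by
  intro θ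
  simp only [eq_iff_iff]
  rw [Ff_add_pi, neg_eq_zero, Ns, Ns, show θ + Real.pi - β = (θ - β) + Real.pi by ring,
    show θ + Real.pi - δ = (θ - δ) + Real.pi by ring]
  simp only [Real.cos_add_pi, neg_sq]

lemma Good_of_ZS {β δ : ℝ} (h : ∀ q ∈ Icc (0:ℝ) 1, ∃ a b c, ZS β δ q a b c) : Good β δ := by
  choose! a b c H using h
  have loc : ∀ q0 ∈ Icc (0:ℝ) 1, ∃ ψ1 ψ2 ψ3 : ℝ → ℝ, (AnalyticAt ℝ ψ1 q0 ∧ AnalyticAt ℝ ψ2 q0 ∧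
      AnalyticAt ℝ ψ3 q0) ∧ ∀ᶠ q in 𝓝 q0, q ∈ Icc (0:ℝ) 1 → a q = ψ1 q ∧ b q = ψ2 q ∧ c q = ψ3 q := by
    intro q0 hq0
    obtain ⟨a0, ab, bc, cp, ⟨Na, Nb, Nc⟩, ⟨fa, fb, fc⟩, ⟨da, db, dc⟩, -⟩ := H q0 hq0
    obtain ⟨ψ1, p1, p2, p3⟩ := branch hq0.1 Na fa da
    obtain ⟨ψ2, r1, r2, r3⟩ := branch hq0.1 Nb fb db
    obtain ⟨ψ3, s1, s2, s3⟩ := branch hq0.1 Nc fc dc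
    refine ⟨ψ1, ψ2, ψ3, ⟨p1, r1, s1⟩, ?_⟩
    have i1 : ∀ᶠ q in 𝓝 q0, 0 < ψ1 q :=
      p1.continuousAt.tendsto.eventually_const_lt (by rw [p2]; exact a0)
    have i2 : ∀ᶠ q in 𝓝 q0, ψ1 q < ψ2 q :=
      p1.continuousAt.tendsto.eventually_lt r1.continuousAt.tendsto (by rw [p2, r2]; exact ab)
    have i3 : ∀ᶠ q in 𝓝 q0, ψ2 q < ψ3 q :=
      r1.continuousAt.tendsto.eventually_lt s1.continuousAt.tendsto (by rw [s2, r2]; exact bc)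
    have i4 : ∀ᶠ q in 𝓝 q0, ψ3 q < Real.pi :=
      s1.continuousAt.tendsto.eventually_lt_const (by rw [s2]; exact cp)
    filter_upwards [p3, r3, s3, i1, i2, i3, i4] with q P R S I1 I2 I3 I4 hq
    obtain ⟨-, ab', bc', -, -, -, -, U⟩ := H q hq
    exact sorted_eq I2 I3 ab' bc' (U _ I1.le (by linarith) P.1 P.2)
      (U _ (by linarith) (by linarith) R.1 R.2) (U _ (by linarith) I4 S.1 S.2)
  obtain ⟨f1, f1a, f1e⟩ := analytic_extend (a := a) (fun q0 hq0 => by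
    obtain ⟨ψ1, ψ2, ψ3, ⟨A1, A2, A3⟩, e⟩ := loc q0 hq0
    exact ⟨ψ1, A1, e.mono fun q h hq => (h hq).1⟩)
  obtain ⟨f2, f2a, f2e⟩ := analytic_extend (a := b) (fun q0 hq0 => by
    obtain ⟨ψ1, ψ2, ψ3, ⟨A1, A2, A3⟩, e⟩ := loc q0 hq0
    exact ⟨ψ2, A2, e.mono fun q h hq => (h hq).2.1⟩)
  obtain ⟨f3, f3a, f3e⟩ := analytic_extend (a := c) (fun q0 hq0 => by
    obtain ⟨ψ1, ψ2, ψ3, ⟨A1, A2, A3⟩, e⟩ := loc q0 hq0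
    exact ⟨ψ3, A3, e.mono fun q h hq => (h hq).2.2⟩)
  refine ⟨![f1, f2, f3], ?_, ?_⟩
  · intro k; fin_cases k
    exacts [f1a, f2a, f3a]
  · intro q hq
    obtain ⟨a0, ab, bc, cp, ⟨Na, Nb, Nc⟩, ⟨fa, fb, fc⟩, -, U⟩ := H q hq
    constructor
    · intro k
      fin_cases k
      · show Ns β δ q (f1 q) ∧ Ff β δ q (f1 q) = 0
        rw [f1e q hq]; exact ⟨Na, fa⟩
      · show Ns β δ q (f2 q) ∧ Ff β δ q (f2 q) = 0
        rw [f2e q hq]; exact ⟨Nb, fb⟩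
      · show Ns β δ q (f3 q) ∧ Ff β δ q (f3 q) = 0
        rw [f3e q hq]; exact ⟨Nc, fc⟩
    · intro θ hN hF
      set n := ⌊θ / Real.pi⌋ with hn
      have hp := Real.pi_pos
      have l1 : n * Real.pi ≤ θ := by
        rw [← le_div_iff₀ hp]; exact Int.floor_le _
      have l2 : θ < (n + 1) * Real.pi := by
        rw [← div_lt_iff₀ hp]; exact Int.lt_floor_add_one _
      have P := ((zero_periodic β δ q).sub_int_mul_eq (x := θ) n)
      have P' : Ns β δ q (θ - n * Real.pi) ∧ Ff β δ q (θ - n * Real.pi) = 0 := by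
        rw [P]; exact ⟨hN, hF⟩
      rcases U (θ - n * Real.pi) (by linarith) (by linarith) P'.1 P'.2 with h | h | h
      · exact ⟨0, n, by show θ = f1 q + _; rw [f1e q hq]; linarith⟩
      · exact ⟨1, n, by show θ = f2 q + _; rw [f2e q hq]; linarith⟩
      · exact ⟨2, n, by show θ = f3 q + _; rw [f3e q hq]; linarith⟩

lemma Good_barrier {β δ : ℝ} (hβ : 0 < β) (hβδ : β < δ)
    (hδ : δ < Real.pi) (h1 : β ≤ Real.pi / 2) (h2 : Real.pi / 2 ≤ δ) : Good β δ := by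
  apply Good_of_ZS
  intro q hq
  rcases hq.2.eq_or_lt with h | h
  · rw [h]; exact ZS_one hβ hβδ hδ
  · exact ZS_lt hq.1 h hβ hβδ hδ h1 h2

lemma Good_rot {β δ : ℝ} (h : Good (δ - β) (Real.pi - β)) : Good β δ := by
  have key : ∀ q θ, (Ns β δ q (θ + β) ↔ Ns (δ - β) (Real.pi - β) q θ) ∧
      Ff β δ q (θ + β) = - Ff (δ - β) (Real.pi - β) q θ := by
    intro q θ
    have e : Real.cos (θ - (Real.pi - β)) = - Real.cos (θ + β) := by
      rw [show θ - (Real.pi - β) = (θ + β) - Real.pi by ring, Real.cos_sub_pi]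
    constructor
    · rw [Ns, Ns, e, neg_sq, add_sub_cancel_right, show θ + β - δ = θ - (δ - β) by ring]
      tauto
    · rw [Ff, Ff, e, Ef_neg, add_sub_cancel_right, show θ + β - δ = θ - (δ - β) by ring,
        show Real.pi - β - (δ - β) = Real.pi - δ by ring, Real.sin_pi_sub, Real.sin_pi_sub]
      ring
  obtain ⟨ϑ, h1, h2⟩ := h
  refine ⟨fun k q => ϑ k q + β, fun k => (h1 k).add analyticOnNhd_const, fun q hq => ⟨fun k => ?_, ?_⟩⟩
  · obtain ⟨h3, h4⟩ := (h2 q hq).1 k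
    exact ⟨(key q _).1.2 h3, by rw [(key q _).2, h4, neg_zero]⟩
  · intro θ hN hF
    have k := key q (θ - β)
    rw [sub_add_cancel] at k
    obtain ⟨j, n, hj⟩ := (h2 q hq).2 (θ - β) (k.1.1 hN) (by linarith [k.2])
    exact ⟨j, n, by simp only; linarith⟩

lemma Good_all {β δ : ℝ} (hβ : 0 < β) (hβδ : β < δ) (hδ : δ < Real.pi) : Good β δ := by
  by_cases h1 : β ≤ Real.pi / 2
  · by_cases h2 : Real.pi / 2 ≤ δ
    · exact Good_barrier hβ hβδ hδ h1 h2
    · push Not at h2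
      apply Good_rot
      exact Good_barrier (by linarith) (by linarith) (by linarith) (by linarith) (by linarith)
  · push Not at h1
    apply Good_rot
    apply Good_rot
    exact Good_barrier (by linarith) (by linarith) (by linarith) (by linarith) (by linarith)

/-! ### Part 6 -/

structure Geo (a b r1 r2 β δ : ℝ) : Prop where
  hb : 0 < b
  h1 : 0 < r1
  h2 : 0 < r2
  hβ : 0 < β
  hβδ : β < δ
  hδ : δ < Real.pi
  c2 : a + 1 = r2 * Real.cos β
  s2 : b = r2 * Real.sin β
  c1 : a - 1 = r1 * Real.cos δ
  s1 : b = r1 * Real.sin δ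

lemma exists_geo (a b : ℝ) (hb : 0 < b) : ∃ r1 r2 β δ, Geo a b r1 r2 β δ := by
  have pol : ∀ x : ℝ, ∃ r α, 0 < r ∧ 0 < α ∧ α < Real.pi ∧ x = r * Real.cos α ∧ b = r * Real.sin α := by
    intro x
    set ζ : ℂ := ⟨x, b⟩ with hζ
    have hne : ζ ≠ 0 := by intro h; have := congrArg Complex.im h; simp [hζ] at this; linarith
    have hr : 0 < ‖ζ‖ := norm_pos_iff.2 hne
    have e1 := Complex.norm_mul_cos_arg ζ
    have e2 := Complex.norm_mul_sin_arg ζ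
    refine ⟨‖ζ‖, ζ.arg, hr, ?_, ?_, e1.symm, e2.symm⟩
    · have h0 : 0 ≤ ζ.arg := Complex.arg_nonneg_iff.2 hb.le
      refine lt_of_le_of_ne h0 fun h => ?_
      rw [← h] at e2; simp [hζ] at e2; linarith
    · refine lt_of_le_of_ne (Complex.arg_le_pi ζ) fun h => ?_
      rw [h] at e2; simp [hζ] at e2; linarith
  obtain ⟨r2, β, hr2, hβ0, hβ1, c2, s2⟩ := pol (a + 1)
  obtain ⟨r1, δ, hr1, hδ0, hδ1, c1, s1⟩ := pol (a - 1)
  refine ⟨r1, r2, β, δ, hb, hr1, hr2, hβ0, ?_, hδ1, c2, s2, c1, s1⟩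
  by_contra hcon
  push Not at hcon
  have h1 : Real.sin (δ - β) ≤ 0 :=
    Real.sin_nonpos_of_nonpos_of_neg_pi_le (by linarith) (by linarith)
  have h2 : r1 * r2 * Real.sin (δ - β) = 2 * b := by
    rw [Real.sin_sub]
    linear_combination (-r2 * Real.cos β) * s1 - b * c2 + (r1 * Real.cos δ) * s2 + b * c1
  have : 0 < r1 * r2 := by positivity
  nlinarith

def N0 (a b : ℝ) (z w : ℂ) : ℂ := (z - a + w) / b

def Np (a b p r : ℝ) (z w : ℂ) : ℂ := ((p - a) * (z - a) + b ^ 2 + r * w) / (b * (z - p))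

def Phi (a b r1 r2 : ℝ) (z w : ℂ) : ℝ :=
  Real.log ‖N0 a b z w‖ - (r1 / 2) * Real.log ‖Np a b 1 r1 z w‖ +
    (r2 / 2) * Real.log ‖Np a b (-1) r2 z w‖

def Zf (a b s : ℝ) (W : ℂ) : ℂ :=
  ((1 - s) * (a + b * I) - s * W * (a - b * I)) / ((1 - s) - s * W)

lemma N0_mul {a b : ℝ} (hb : 0 < b) {z w : ℂ} (hw : w ^ 2 = (z - a) ^ 2 + b ^ 2) :
    N0 a b z w * N0 a b z (-w) = -1 := by
  have : (b:ℂ) ≠ 0 := by exact_mod_cast hb.ne'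
  unfold N0
  field_simp
  linear_combination - hw

lemma Np_mul {a b p r : ℝ} (hb : 0 < b) (hr : r ^ 2 = (p - a) ^ 2 + b ^ 2) {z w : ℂ}
    (hz : z ≠ p) (hw : w ^ 2 = (z - a) ^ 2 + b ^ 2) :
    Np a b p r z w * Np a b p r z (-w) = -1 := by
  have hb' : (b:ℂ) ≠ 0 := by exact_mod_cast hb.ne'
  have hz' := sub_ne_zero.2 hz
  have hr' : (r:ℂ) ^ 2 = (p - a) ^ 2 + b ^ 2 := by exact_mod_cast hr
  unfold Np
  field_simp
  linear_combination (-(r:ℂ)^2) * hw - ((z - a) ^ 2 + b ^ 2) * hr'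

lemma normsq_add {c σ α : ℝ} (h : c ^ 2 + σ ^ 2 = 1) :
    ‖(c:ℂ) + σ * cexp (α * I)‖ ^ 2 = 1 + 2 * c * σ * Real.cos α := by
  rw [Complex.sq_norm, Complex.normSq_apply]
  simp [Complex.exp_ofReal_mul_I_re, Complex.exp_ofReal_mul_I_im]
  linear_combination h + σ ^ 2 * Real.sin_sq_add_cos_sq α

lemma normsq_sub {c σ α : ℝ} (h : c ^ 2 + σ ^ 2 = 1) :
    ‖(c:ℂ) - σ * cexp (α * I)‖ ^ 2 = 1 - 2 * c * σ * Real.cos α := by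
  have := normsq_add (c := c) (σ := -σ) (α := α) (by rw [neg_sq]; exact h)
  push_cast at this
  rw [sub_eq_add_neg, ← neg_mul, this]; ring

lemma log_ratio {c σ α : ℝ} (h : c ^ 2 + σ ^ 2 = 1) (hN : (2 * c * σ) ^ 2 * Real.cos α ^ 2 < 1) :
    Real.log ‖((c:ℂ) + σ * cexp (α * I)) / (c - σ * cexp (α * I))‖ =
      Ath (2 * c * σ * Real.cos α) := by
  have hx := mul_sq_lt_abs hN
  rw [abs_lt] at hx
  have e1 := normsq_add (α := α) h
  have e2 := normsq_sub (α := α) h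
  have n1 : ‖(c:ℂ) + σ * cexp (α * I)‖ ≠ 0 := by
    intro h0; rw [h0] at e1; norm_num at e1; linarith
  have n2 : ‖(c:ℂ) - σ * cexp (α * I)‖ ≠ 0 := by
    intro h0; rw [h0] at e2; norm_num at e2; linarith
  rw [norm_div, Real.log_div n1 n2, Ath, ← e1, ← e2, Real.log_pow, Real.log_pow]
  push_cast; ring

lemma D_ne {c σ α : ℝ} (h : c ^ 2 + σ ^ 2 = 1) :
    ‖(c:ℂ) ^ 2 - σ ^ 2 * cexp (α * I) ^ 2‖ ^ 2 = 1 - (2 * c * σ) ^ 2 * Real.cos α ^ 2 := by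
  rw [show (c:ℂ) ^ 2 - σ ^ 2 * cexp (α * I) ^ 2 = (c + σ * cexp (α * I)) * (c - σ * cexp (α * I)) by ring,
    norm_mul, mul_pow, normsq_add h, normsq_sub h]
  ring

lemma N0_polar {a b c σ : ℝ} {e z w : ℂ} (hb : 0 < b) (hD : (c:ℂ) ^ 2 - σ ^ 2 * e ^ 2 ≠ 0)
    (hz : z = (c ^ 2 * (a + b * I) - σ ^ 2 * e ^ 2 * (a - b * I)) / (c ^ 2 - σ ^ 2 * e ^ 2))
    (hw : w = 2 * I * b * c * σ * e / (c ^ 2 - σ ^ 2 * e ^ 2)) :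
    N0 a b z w = I * ((c + σ * e) / (c - σ * e)) := by
  have hb' : (b:ℂ) ≠ 0 := by exact_mod_cast hb.ne'
  have f : (c:ℂ) ^ 2 - σ ^ 2 * e ^ 2 = (c + σ * e) * (c - σ * e) := by ring
  have n1 : (c:ℂ) + σ * e ≠ 0 := fun h => hD (by rw [f, h, zero_mul])
  have n2 : (c:ℂ) - σ * e ≠ 0 := fun h => hD (by rw [f, h, mul_zero])
  rw [N0, hz, hw, f]
  field_simp
  ring

lemma Np_polar {a b c σ p r : ℝ} {e ep z w : ℂ} (hb : 0 < b) (hr : r ≠ 0) (hep : ep ≠ 0)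
    (hD : (c:ℂ) ^ 2 - σ ^ 2 * e ^ 2 ≠ 0)
    (hz : z = (c ^ 2 * (a + b * I) - σ ^ 2 * e ^ 2 * (a - b * I)) / (c ^ 2 - σ ^ 2 * e ^ 2))
    (hw : w = 2 * I * b * c * σ * e / (c ^ 2 - σ ^ 2 * e ^ 2))
    (h1 : (a + b * I : ℂ) = p + r * ep) (h2 : (a - b * I : ℂ) = p + r * ep⁻¹) :
    z - p = r * ep * (c ^ 2 - σ ^ 2 * (e / ep) ^ 2) / (c ^ 2 - σ ^ 2 * e ^ 2) ∧
    (z ≠ p → Np a b p r z w = -I * ((c + σ * (e / ep)) / (c - σ * (e / ep)))⁻¹) := by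
  have hb' : (b:ℂ) ≠ 0 := by exact_mod_cast hb.ne'
  have hr' : (r:ℂ) ≠ 0 := by exact_mod_cast hr
  have e1 : z - p = r * ep * (c ^ 2 - σ ^ 2 * (e / ep) ^ 2) / (c ^ 2 - σ ^ 2 * e ^ 2) := by
    rw [hz, h1, h2]
    field_simp
    ring
  refine ⟨e1, fun hzp => ?_⟩
  have n0 : (c:ℂ) ^ 2 - σ ^ 2 * (e / ep) ^ 2 ≠ 0 := by
    intro h; rw [h] at e1; apply hzp; rw [← sub_eq_zero, e1]; simp
  have f : (c:ℂ) ^ 2 - σ ^ 2 * (e / ep) ^ 2 = (c + σ * (e / ep)) * (c - σ * (e / ep)) := by ring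
  have n1 : (c:ℂ) + σ * (e / ep) ≠ 0 := fun h => n0 (by rw [f, h, zero_mul])
  have n2 : (c:ℂ) - σ * (e / ep) ≠ 0 := fun h => n0 (by rw [f, h, mul_zero])
  have num : ((p - a) * (z - a) + b ^ 2 + r * w : ℂ) =
      -I * b * r * ep * (c - σ * (e / ep)) ^ 2 / (c ^ 2 - σ ^ 2 * e ^ 2) := by
    have hpa : (p - a : ℂ) = I * b - r * ep := by linear_combination (-1:ℂ) * h1
    have hza : z - a = I * b * (c ^ 2 + σ ^ 2 * e ^ 2) / (c ^ 2 - σ ^ 2 * e ^ 2) := by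
      rw [hz]; field_simp; ring
    have hd : 2 * I * b = r * (ep - ep⁻¹) := by linear_combination h1 - h2
    have hd' : 2 * I * b * ep = r * (ep ^ 2 - 1) := by rw [hd]; field_simp
    rw [hpa, hza, hw]
    field_simp
    have hI := Complex.I_sq
    linear_combination (σ ^ 2 * e ^ 2 * I) * hd' + b * ep * (c ^ 2 - σ ^ 2 * e ^ 2) * hI
  rw [Np, num, e1, f]
  field_simp

/-! ### Part 7 -/

lemma exp_eq_cs (x : ℝ) : cexp (x * I) = Real.cos x + Real.sin x * I := by
  rw [Complex.exp_mul_I, Complex.ofReal_cos, Complex.ofReal_sin]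

lemma exp_inv_cs (x : ℝ) : (cexp (x * I))⁻¹ = Real.cos x - Real.sin x * I := by
  rw [← Complex.exp_neg, ← neg_mul, ← Complex.ofReal_neg, exp_eq_cs, Real.cos_neg, Real.sin_neg]
  push_cast; ring

section
variable {a b r1 r2 β δ : ℝ}

lemma Geo.e2 (G : Geo a b r1 r2 β δ) : (a + b * I : ℂ) = ((-1 : ℝ) : ℂ) + r2 * cexp (β * I) := by
  have h1 : (a:ℂ) + 1 = r2 * Real.cos β := by exact_mod_cast G.c2
  have h2 : (b:ℂ) = r2 * Real.sin β := by exact_mod_cast G.s2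
  rw [exp_eq_cs]
  push_cast at *
  linear_combination h1 + I * h2

lemma Geo.e2' (G : Geo a b r1 r2 β δ) :
    (a - b * I : ℂ) = ((-1 : ℝ) : ℂ) + r2 * (cexp (β * I))⁻¹ := by
  have h1 : (a:ℂ) + 1 = r2 * Real.cos β := by exact_mod_cast G.c2
  have h2 : (b:ℂ) = r2 * Real.sin β := by exact_mod_cast G.s2
  rw [exp_inv_cs]
  push_cast at *
  linear_combination h1 - I * h2

lemma Geo.e1 (G : Geo a b r1 r2 β δ) : (a + b * I : ℂ) = ((1 : ℝ) : ℂ) + r1 * cexp (δ * I) := by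
  have h1 : (a:ℂ) - 1 = r1 * Real.cos δ := by exact_mod_cast G.c1
  have h2 : (b:ℂ) = r1 * Real.sin δ := by exact_mod_cast G.s1
  rw [exp_eq_cs]
  push_cast at *
  linear_combination h1 + I * h2

lemma Geo.e1' (G : Geo a b r1 r2 β δ) :
    (a - b * I : ℂ) = ((1 : ℝ) : ℂ) + r1 * (cexp (δ * I))⁻¹ := by
  have h1 : (a:ℂ) - 1 = r1 * Real.cos δ := by exact_mod_cast G.c1
  have h2 : (b:ℂ) = r1 * Real.sin δ := by exact_mod_cast G.s1
  rw [exp_inv_cs]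
  push_cast at *
  linear_combination h1 - I * h2

lemma Geo.r1sq (G : Geo a b r1 r2 β δ) : r1 ^ 2 = (1 - a) ^ 2 + b ^ 2 := by
  have h1 := G.c1
  have h2 := G.s1
  have := Real.sin_sq_add_cos_sq δ
  have e : (1 - a) ^ 2 + b ^ 2 = (a - 1) ^ 2 + b ^ 2 := by ring
  rw [e, h1]; rw [h2]
  linear_combination (-r1^2) * this

lemma Geo.r2sq (G : Geo a b r1 r2 β δ) : r2 ^ 2 = (-1 - a) ^ 2 + b ^ 2 := by
  have h1 := G.c2
  have h2 := G.s2
  have := Real.sin_sq_add_cos_sq β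
  have e : (-1 - a) ^ 2 + b ^ 2 = (a + 1) ^ 2 + b ^ 2 := by ring
  rw [e, h1]; rw [h2]
  linear_combination (-r2^2) * this

lemma Geo.sd (G : Geo a b r1 r2 β δ) : r1 * r2 * Real.sin (δ - β) = 2 * b := by
  rw [Real.sin_sub]
  linear_combination (-r2 * Real.cos β) * G.s1 - b * G.c2 + (r1 * Real.cos δ) * G.s2 + b * G.c1

lemma exp_div (θ p : ℝ) : cexp (θ * I) / cexp (p * I) = cexp ((θ - p : ℝ) * I) := by
  rw [← Complex.exp_sub]; congr 1; push_cast; ring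

lemma Ath_Ef {κ x : ℝ} (h : κ ^ 2 * x ^ 2 < 1) :
    Ath (κ * x) = κ * x + κ ^ 3 * Ef (κ ^ 2) x := by
  rw [Ath_eq (mul_sq_lt_abs h), Ef, mul_pow κ x 2]; ring

/-- polar representation relation -/
def Pol (a b c σ θ : ℝ) (z w : ℂ) : Prop :=
  (c:ℂ) ^ 2 - σ ^ 2 * cexp (θ * I) ^ 2 ≠ 0 ∧
  z = (c ^ 2 * (a + b * I) - σ ^ 2 * cexp (θ * I) ^ 2 * (a - b * I)) /
    (c ^ 2 - σ ^ 2 * cexp (θ * I) ^ 2) ∧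
  w = 2 * I * b * c * σ * cexp (θ * I) / (c ^ 2 - σ ^ 2 * cexp (θ * I) ^ 2)

lemma Pol.sub (G : Geo a b r1 r2 β δ) {c σ θ : ℝ} {z w : ℂ} (h : Pol a b c σ θ z w) :
    z - 1 = r1 * cexp (δ * I) * (c ^ 2 - σ ^ 2 * (cexp ((θ - δ : ℝ) * I)) ^ 2) /
      (c ^ 2 - σ ^ 2 * cexp (θ * I) ^ 2) ∧
    z + 1 = r2 * cexp (β * I) * (c ^ 2 - σ ^ 2 * (cexp ((θ - β : ℝ) * I)) ^ 2) /
      (c ^ 2 - σ ^ 2 * cexp (θ * I) ^ 2) := by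
  obtain ⟨hD, hz, hw⟩ := h
  have k1 := (Np_polar G.hb G.h1.ne' (Complex.exp_ne_zero _) hD hz hw G.e1 G.e1').1
  have k2 := (Np_polar G.hb G.h2.ne' (Complex.exp_ne_zero _) hD hz hw G.e2 G.e2').1
  rw [exp_div] at k1 k2
  push_cast at k1 k2 ⊢
  exact ⟨k1, by rw [← k2]; ring⟩

lemma Pol.ne (G : Geo a b r1 r2 β δ) {c σ θ : ℝ} (h : c ^ 2 + σ ^ 2 = 1) {z w : ℂ}
    (hp : Pol a b c σ θ z w) (hN : Ns β δ ((2 * c * σ) ^ 2) θ) : z ≠ 1 ∧ z ≠ -1 := by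
  obtain ⟨k1, k2⟩ := hp.sub G
  have n : ∀ α : ℝ, (2 * c * σ) ^ 2 * Real.cos α ^ 2 < 1 →
      (c:ℂ) ^ 2 - σ ^ 2 * cexp (α * I) ^ 2 ≠ 0 := by
    intro α hα h0
    have := D_ne (α := α) h
    rw [h0] at this; norm_num at this; linarith
  have h1 : (r1:ℂ) ≠ 0 := by exact_mod_cast G.h1.ne'
  have h2 : (r2:ℂ) ≠ 0 := by exact_mod_cast G.h2.ne'
  constructor
  · rw [← sub_ne_zero, k1]
    exact div_ne_zero (mul_ne_zero (mul_ne_zero h1 (Complex.exp_ne_zero _)) (n _ hN.2.2)) hp.1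
  · intro hz
    have : z + 1 ≠ 0 := by
      rw [k2]
      exact div_ne_zero (mul_ne_zero (mul_ne_zero h2 (Complex.exp_ne_zero _)) (n _ hN.2.1)) hp.1
    apply this; rw [hz]; ring

lemma Pol.Ns (G : Geo a b r1 r2 β δ) {c σ θ : ℝ} (h : c ^ 2 + σ ^ 2 = 1) {z w : ℂ}
    (hp : Pol a b c σ θ z w) (hz1 : z ≠ 1) (hz2 : z ≠ -1) : Ns β δ ((2 * c * σ) ^ 2) θ := by
  obtain ⟨k1, k2⟩ := hp.sub G
  have n : ∀ α : ℝ, (c:ℂ) ^ 2 - σ ^ 2 * cexp (α * I) ^ 2 ≠ 0 →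
      (2 * c * σ) ^ 2 * Real.cos α ^ 2 < 1 := by
    intro α hα
    have := D_ne (α := α) h
    have h2 : 0 < ‖(c:ℂ) ^ 2 - σ ^ 2 * cexp (α * I) ^ 2‖ := norm_pos_iff.2 hα
    nlinarith
  refine ⟨n _ hp.1, n _ ?_, n _ ?_⟩
  · intro h0; rw [h0] at k2; apply hz2; rw [eq_neg_iff_add_eq_zero, k2]; simp
  · intro h0; rw [h0] at k1; apply hz1; rw [← sub_eq_zero, k1]; simp

lemma Pol.Phi (G : Geo a b r1 r2 β δ) {c σ θ : ℝ} (h : c ^ 2 + σ ^ 2 = 1) {z w : ℂ}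
    (hp : Pol a b c σ θ z w) (hz1 : z ≠ 1) (hz2 : z ≠ -1) :
    Phi a b r1 r2 z w = (2 * c * σ) ^ 3 * (r1 * r2 / (2 * b)) * Ff β δ ((2 * c * σ) ^ 2) θ := by
  obtain ⟨N0', N1', N2'⟩ := hp.Ns G h hz1 hz2
  obtain ⟨hD, hz, hw⟩ := hp
  have k1 := (Np_polar G.hb G.h1.ne' (Complex.exp_ne_zero _) hD hz hw G.e1 G.e1').2
    (by simpa using hz1)
  have k2 := (Np_polar G.hb G.h2.ne' (Complex.exp_ne_zero _) hD hz hw G.e2 G.e2').2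
    (by simpa using hz2)
  have k0 := N0_polar G.hb hD hz hw
  rw [exp_div] at k1 k2
  have hb := G.hb.ne'
  rw [_root_.Phi, k0, k1, k2]
  simp only [norm_mul, norm_neg, Complex.norm_I, one_mul, norm_inv, Real.log_inv]
  rw [log_ratio h N0', log_ratio h N1', log_ratio h N2', Ath_Ef N0', Ath_Ef N1', Ath_Ef N2', Ff]
  have s0 : Real.sin (δ - β) = 2 * b / (r1 * r2) := by
    rw [eq_div_iff (mul_pos G.h1 G.h2).ne']; linarith [G.sd]
  have s1 : Real.sin δ = b / r1 := by rw [eq_div_iff G.h1.ne']; linarith [G.s1]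
  have s2 : Real.sin β = b / r2 := by rw [eq_div_iff G.h2.ne']; linarith [G.s2]
  have h1 := G.h1.ne'
  have h2 := G.h2.ne'
  have lin : Real.cos θ + (r1 / 2) * Real.cos (θ - δ) - (r2 / 2) * Real.cos (θ - β) = 0 := by
    rw [Real.cos_sub, Real.cos_sub]
    linear_combination (-Real.cos θ / 2) * G.c1 + (Real.cos θ / 2) * G.c2 -
      (Real.sin θ / 2) * G.s1 + (Real.sin θ / 2) * G.s2
  rw [s0, s1, s2]
  generalize Ef ((2 * c * σ) ^ 2) (Real.cos θ) = E0
  generalize Ef ((2 * c * σ) ^ 2) (Real.cos (θ - β)) = E1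
  generalize Ef ((2 * c * σ) ^ 2) (Real.cos (θ - δ)) = E2
  have : (2 * c * σ) ^ 3 * (r1 * r2 / (2 * b)) *
      (2 * b / (r1 * r2) * E0 - b / r1 * E1 + b / r2 * E2) =
      (2 * c * σ) ^ 3 * (E0 - r2 / 2 * E1 + r1 / 2 * E2) := by field_simp
  rw [this]
  linear_combination (2 * c * σ) * lin

lemma exists_Pol (hb : 0 < b) {z w : ℂ} (hw : w ^ 2 = (z - a) ^ 2 + b ^ 2) :
    ∃ c σ θ : ℝ, 0 ≤ c ∧ 0 ≤ σ ∧ c ^ 2 + σ ^ 2 = 1 ∧ Pol a b c σ θ z w := by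
  have hb' : (b:ℂ) ≠ 0 := by exact_mod_cast hb.ne'
  have hI := Complex.I_sq
  by_cases hz : z = a - b * I
  · have hw0 : w = 0 := by
      have : w ^ 2 = 0 := by rw [hw, hz]; linear_combination b ^ 2 * hI
      exact pow_eq_zero_iff (two_ne_zero) |>.1 this
    refine ⟨0, 1, 0, le_rfl, zero_le_one, by norm_num, ?_, ?_, ?_⟩
    · simp
    · simp [hz, div_neg]
    · simp [hw0]
  · have hz' : z - (a - b * I) ≠ 0 := sub_ne_zero.2 hz
    set u := w / (z - (a - b * I)) with hu
    have hu2 : u ^ 2 * (z - (a - b * I)) = z - (a + b * I) := by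
      rw [hu, div_pow]; field_simp; rw [hw]; linear_combination (b ^ 2 : ℂ) * hI
    have hu1 : w = u * (z - (a - b * I)) := by rw [hu]; field_simp
    set ρ := ‖u‖ with hρ
    have hρ0 : 0 ≤ ρ := norm_nonneg _
    have hpos : 0 < 1 + ρ ^ 2 := by positivity
    set m := Real.sqrt (1 + ρ ^ 2) with hm
    have hm0 : 0 < m := Real.sqrt_pos.2 hpos
    have hm2 : m ^ 2 = 1 + ρ ^ 2 := Real.sq_sqrt hpos.le
    have hpol : u = ρ * cexp (u.arg * I) := (Complex.norm_mul_exp_arg_mul_I u).symm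
    refine ⟨1 / m, ρ / m, u.arg, by positivity, by positivity, ?_, ?_⟩
    · field_simp; linarith
    set e := cexp (u.arg * I) with he
    have hmc : (m:ℂ) ≠ 0 := by exact_mod_cast hm0.ne'
    have hD : (1 - u ^ 2 : ℂ) ≠ 0 := by
      intro h0
      have : u ^ 2 = 1 := by linear_combination - h0
      rw [this] at hu2
      have : (2 * I * b : ℂ) = 0 := by linear_combination hu2
      simp [hb'] at this
    have eD : (((1 / m : ℝ) : ℂ) ^ 2 - ((ρ / m : ℝ) : ℂ) ^ 2 * e ^ 2) = (1 - u ^ 2) / m ^ 2 := by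
      rw [hpol]; push_cast; field_simp
    have hzD : z = ((a + b * I) - u ^ 2 * (a - b * I)) / (1 - u ^ 2) := by
      rw [eq_div_iff hD]; linear_combination - hu2
    refine ⟨?_, ?_, ?_⟩
    · rw [eD]; exact div_ne_zero hD (pow_ne_zero _ hmc)
    · rw [eD]
      have : (((1 / m : ℝ) : ℂ) ^ 2 * (a + b * I) - ((ρ / m : ℝ) : ℂ) ^ 2 * e ^ 2 * (a - b * I)) =
        ((a + b * I) - u ^ 2 * (a - b * I)) / m ^ 2 := by
        rw [hpol]; push_cast; field_simp
      rw [this, hzD]; field_simp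
    · rw [eD]
      have : (2 * I * b * ((1 / m : ℝ) : ℂ) * ((ρ / m : ℝ) : ℂ) * e) = 2 * I * b * u / m ^ 2 := by
        conv_rhs => rw [hpol]
        push_cast; field_simp
      rw [this, hu1, hzD]; field_simp; ring
end

/-! ### Part 8 -/

lemma Ef_bound {q x : ℝ} (h0 : 0 ≤ q) (h1 : q ≤ 1 / 2) (hx : |x| ≤ 1) : |Ef q x| ≤ Lf (1 / 2) := by
  have hx2 : x ^ 2 ≤ 1 := by rw [← sq_abs]; nlinarith [abs_nonneg x]
  have hq : q * x ^ 2 ≤ 1 / 2 := by nlinarith [sq_nonneg x]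
  have l1 := Lf_mono (by positivity : 0 ≤ q * x ^ 2) hq (by norm_num)
  have l2 := Lf_pos (by positivity : 0 ≤ q * x ^ 2) (by linarith)
  rw [Ef, abs_mul, abs_of_pos l2, abs_pow]
  have : |x| ^ 3 ≤ 1 := pow_le_one₀ (abs_nonneg _) hx
  nlinarith [abs_nonneg x]

lemma Ff_bound {β δ q θ : ℝ} (h0 : 0 ≤ q) (h1 : q ≤ 1 / 2) : |Ff β δ q θ| ≤ 3 * Lf (1 / 2) := by
  have E : ∀ x, |Ef q (Real.cos x)| ≤ Lf (1 / 2) := fun x => Ef_bound h0 h1 (Real.abs_cos_le_one x)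
  have M : ∀ y x, |Real.sin y * Ef q (Real.cos x)| ≤ Lf (1 / 2) := by
    intro y x
    rw [abs_mul]
    have := Real.abs_sin_le_one y
    have := E x
    nlinarith [abs_nonneg (Real.sin y), abs_nonneg (Ef q (Real.cos x))]
  have m1 := abs_le.1 (M (δ - β) θ)
  have m2 := abs_le.1 (M δ (θ - β))
  have m3 := abs_le.1 (M β (θ - δ))
  rw [Ff, abs_le]
  constructor <;> linarith

section
variable {a b r1 r2 β δ : ℝ}

lemma Phi_bound (G : Geo a b r1 r2 β δ) : ∃ C, 0 ≤ C ∧ ∀ z w : ℂ, z ≠ 1 → z ≠ -1 →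
    w ^ 2 = (z - a) ^ 2 + b ^ 2 → ‖w‖ ^ 2 ≤ b ^ 2 / 2 → |Phi a b r1 r2 z w| ≤ C * ‖w‖ ^ 3 := by
  have hb := G.hb
  have h1 := G.h1
  have h2 := G.h2
  have hL : 0 < Lf (1 / 2) := Lf_pos (by norm_num) (by norm_num)
  refine ⟨(r1 * r2 / (2 * b)) * (3 * Lf (1 / 2)) / b ^ 3, by positivity, ?_⟩
  intro z w hz1 hz2 hw hwb
  obtain ⟨c, σ, θ, hc, hσ, hcs, hp⟩ := exists_Pol G.hb hw
  rw [hp.Phi G hcs hz1 hz2]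
  obtain ⟨hD, -, hw'⟩ := hp
  have hDn := D_ne (α := θ) hcs
  set D := (c:ℂ) ^ 2 - σ ^ 2 * cexp (θ * I) ^ 2 with hDd
  have hD0 : 0 < ‖D‖ := norm_pos_iff.2 hD
  have hD1 : ‖D‖ ≤ 1 := by
    have : ‖D‖ ^ 2 ≤ 1 := by rw [hDn]; nlinarith [sq_nonneg ((2 * c * σ) * Real.cos θ)]
    nlinarith
  have hκ0 : 0 ≤ 2 * c * σ := by positivity
  have hwn : ‖w‖ = b * (2 * c * σ) / ‖D‖ := by
    rw [hw', norm_div]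
    simp only [norm_mul, Complex.norm_I, Complex.norm_exp_ofReal_mul_I, Complex.norm_real,
      Real.norm_of_nonneg hb.le, Real.norm_of_nonneg hc, Real.norm_of_nonneg hσ, Complex.norm_ofNat]
    ring
  have hκ : 2 * c * σ ≤ ‖w‖ / b := by
    rw [hwn, le_div_iff₀ hb, le_div_iff₀ hD0]
    have : 0 ≤ 2 * c * σ * b := by positivity
    nlinarith
  have hq : (2 * c * σ) ^ 2 ≤ 1 / 2 := by
    calc (2 * c * σ) ^ 2 ≤ (‖w‖ / b) ^ 2 := by gcongr
      _ = ‖w‖ ^ 2 / b ^ 2 := by rw [div_pow]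
      _ ≤ 1 / 2 := by rw [div_le_iff₀ (by positivity)]; linarith
  have hF := Ff_bound (β := β) (δ := δ) (θ := θ) (sq_nonneg (2 * c * σ)) hq
  rw [abs_mul, abs_of_nonneg (by positivity)]
  calc (2 * c * σ) ^ 3 * (r1 * r2 / (2 * b)) * |Ff β δ ((2 * c * σ) ^ 2) θ|
      ≤ (‖w‖ / b) ^ 3 * (r1 * r2 / (2 * b)) * (3 * Lf (1 / 2)) := by gcongr
    _ = _ := by rw [div_pow]; ring

lemma hasDerivAt_log_norm {f : ℝ → ℂ} {f' : ℂ} {t : ℝ} (hf : HasDerivAt f f' t) (h0 : f t ≠ 0) :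
    HasDerivAt (fun s => Real.log ‖f s‖) (f' / f t).re t := by
  have h1 := hf.norm_sq
  have hn : ‖f t‖ ^ 2 ≠ 0 := by simpa using h0
  have h2 := (h1.log hn).const_mul (1 / 2 : ℝ)
  have e : (fun s => Real.log ‖f s‖) = fun s => 1 / 2 * Real.log (‖f s‖ ^ 2) := by
    funext s; rw [Real.log_pow]; push_cast; ring
  rw [e]
  refine h2.congr_deriv ?_
  rw [Complex.inner, Complex.div_re, Complex.sq_norm]
  have : Complex.normSq (f t) ≠ 0 := by simpa using h0
  simp
  field_simp

lemma sqrt_hasDerivAt {g P : ℝ → ℂ} {P' : ℂ} {t : ℝ} (hP : HasDerivAt P P' t)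
    (hg : ContinuousAt g t) (h0 : g t ≠ 0) (hgP : ∀ᶠ s in 𝓝 t, g s ^ 2 = P s) :
    HasDerivAt g (P' / (2 * g t)) t := by
  rw [hasDerivAt_iff_tendsto_slope] at hP ⊢
  have hsum : Tendsto (fun s => g s + g t) (𝓝[≠] t) (𝓝 (2 * g t)) := by
    have : Tendsto (fun s => g s + g t) (𝓝 t) (𝓝 (g t + g t)) := hg.tendsto.add_const _
    rw [← two_mul] at this
    exact this.mono_left nhdsWithin_le_nhds
  have h2 : 2 * g t ≠ 0 := by simpa using h0
  have hne := hsum.eventually_ne h2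
  refine (hP.div hsum h2).congr' ?_
  filter_upwards [hne, mem_nhdsWithin_of_mem_nhds hgP] with s h3 h4
  have h5 := hgP.self_of_nhds
  have h4' : g s ^ 2 = P s := h4
  simp only [Pi.div_apply]
  rw [div_eq_iff h3, slope_def_module, slope_def_module, smul_mul_assoc, ← h4', ← h5]
  congr 1; ring

lemma N0_ne (hb : 0 < b) {z w : ℂ} (hw : w ^ 2 = (z - a) ^ 2 + b ^ 2) : N0 a b z w ≠ 0 := by
  intro h
  have := N0_mul hb hw
  rw [h, zero_mul] at this
  norm_num at this

lemma Np_ne {p r : ℝ} (hb : 0 < b) (hr : r ^ 2 = (p - a) ^ 2 + b ^ 2) {z w : ℂ}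
    (hz : z ≠ p) (hw : w ^ 2 = (z - a) ^ 2 + b ^ 2) : Np a b p r z w ≠ 0 := by
  intro h
  have := Np_mul hb hr hz hw
  rw [h, zero_mul] at this
  norm_num at this

lemma N0_deriv (hb : 0 < b) {γ g : ℝ → ℂ} {γ' : ℂ} {t : ℝ} (hγ : HasDerivAt γ γ' t)
    (hg : HasDerivAt g ((γ t - a) * γ' / g t) t) (h0 : g t ≠ 0)
    (hw : g t ^ 2 = (γ t - a) ^ 2 + b ^ 2) :
    HasDerivAt (fun s => Real.log ‖N0 a b (γ s) (g s)‖) (γ' / g t).re t := by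
  have h1 : HasDerivAt (fun s => N0 a b (γ s) (g s)) ((γ' + (γ t - a) * γ' / g t) / b) t := by
    unfold N0
    exact ((hγ.sub_const _).add hg).div_const _
  refine (hasDerivAt_log_norm h1 (N0_ne hb hw)).congr_deriv ?_
  have hb' : (b:ℂ) ≠ 0 := by exact_mod_cast hb.ne'
  have n := N0_ne hb hw
  congr 1
  rw [div_eq_iff n, N0]
  field_simp
  ring

lemma Np_deriv {p r : ℝ} (hb : 0 < b) (hr : r ^ 2 = (p - a) ^ 2 + b ^ 2)
    {γ g : ℝ → ℂ} {γ' : ℂ} {t : ℝ} (hγ : HasDerivAt γ γ' t) (hz : γ t ≠ p)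
    (hg : HasDerivAt g ((γ t - a) * γ' / g t) t) (h0 : g t ≠ 0)
    (hw : g t ^ 2 = (γ t - a) ^ 2 + b ^ 2) :
    HasDerivAt (fun s => Real.log ‖Np a b p r (γ s) (g s)‖)
      (-(r * γ') / (g t * (γ t - p))).re t := by
  have hb' : (b:ℂ) ≠ 0 := by exact_mod_cast hb.ne'
  have hz' := sub_ne_zero.2 hz
  have hr' : (r:ℂ) ^ 2 = (p - a) ^ 2 + b ^ 2 := by exact_mod_cast hr
  have hnum : HasDerivAt (fun s => (p - a) * (γ s - a) + b ^ 2 + r * g s : ℝ → ℂ)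
      ((p - a) * γ' + r * ((γ t - a) * γ' / g t)) t := by
    exact (((hγ.sub_const _).const_mul _).add_const _).add (hg.const_mul _)
  have hden : HasDerivAt (fun s => b * (γ s - p) : ℝ → ℂ) (b * γ') t :=
    (hγ.sub_const _).const_mul _
  have h1 := hnum.div hden (mul_ne_zero hb' hz')
  have n := Np_ne hb hr hz hw
  refine (hasDerivAt_log_norm (f := fun s => Np a b p r (γ s) (g s)) h1 n).congr_deriv ?_
  congr 1
  rw [div_eq_iff n, Np]
  field_simp
  linear_combination (γ' * g t) * hr' - (γ' * r) * hw
end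

/-! ### Part 9 -/

section
variable {a b r1 r2 β δ : ℝ}

lemma Phi_deriv (G : Geo a b r1 r2 β δ) {γ g : ℝ → ℂ} {γ' : ℂ} {t : ℝ} (hγ : HasDerivAt γ γ' t)
    (hz1 : γ t ≠ 1) (hz2 : γ t ≠ -1) (hgc : ContinuousAt g t)
    (hw : ∀ᶠ s in 𝓝 t, g s ^ 2 = (γ s - a) ^ 2 + b ^ 2) (h0 : g t ≠ 0) :
    HasDerivAt (fun s => Phi a b r1 r2 (γ s) (g s)) (g t / ((γ t) ^ 2 - 1) * γ').re t := by
  have hw0 := hw.self_of_nhds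
  have hP : HasDerivAt (fun s => (γ s - a) ^ 2 + b ^ 2 : ℝ → ℂ) (2 * (γ t - a) * γ') t := by
    refine (((hγ.sub_const (a:ℂ)).pow 2).add_const _).congr_deriv ?_
    simp
  have hg : HasDerivAt g ((γ t - a) * γ' / g t) t := by
    refine (sqrt_hasDerivAt hP hgc h0 hw).congr_deriv ?_
    field_simp
  have hb := G.hb
  have d0 := N0_deriv hb hγ hg h0 hw0
  have d1 := Np_deriv (p := 1) hb G.r1sq hγ (by simpa using hz1) hg h0 hw0
  have d2 := Np_deriv (p := -1) hb G.r2sq hγ (by simpa using hz2) hg h0 hw0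
  unfold Phi
  refine ((d0.sub (d1.const_mul (r1 / 2))).add (d2.const_mul (r2 / 2))).congr_deriv ?_
  have n1 := sub_ne_zero.2 hz1
  have n2 : γ t + 1 ≠ 0 := by intro h; exact hz2 (eq_neg_of_add_eq_zero_left h)
  have n3 : (γ t) ^ 2 - 1 ≠ 0 := by
    rw [show (γ t) ^ 2 - 1 = (γ t - 1) * (γ t + 1) by ring]; exact mul_ne_zero n1 n2
  rw [← Complex.re_ofReal_mul, ← Complex.re_ofReal_mul, ← Complex.sub_re, ← Complex.add_re]
  congr 1
  have k1 : (r1:ℂ) ^ 2 = (1 - a) ^ 2 + b ^ 2 := by exact_mod_cast G.r1sq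
  have k2 : (r2:ℂ) ^ 2 = (-1 - a) ^ 2 + b ^ 2 := by exact_mod_cast G.r2sq
  push_cast
  rw [sub_neg_eq_add, show (γ t) ^ 2 - 1 = (γ t - 1) * (γ t + 1) by ring]
  field_simp
  linear_combination γ' * ((-2:ℂ) * hw0 + (γ t + 1) * k1 - (γ t - 1) * k2)

lemma Phi_deriv_zero (G : Geo a b r1 r2 β δ) {γ g : ℝ → ℂ} {γ' : ℂ} {t : ℝ} (hγ : HasDerivAt γ γ' t)
    (hz1 : γ t ≠ 1) (hz2 : γ t ≠ -1) (hgc : ContinuousAt g t)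
    (hw : ∀ᶠ s in 𝓝 t, g s ^ 2 = (γ s - a) ^ 2 + b ^ 2) (h0 : g t = 0) :
    HasDerivAt (fun s => Phi a b r1 r2 (γ s) (g s)) 0 t := by
  obtain ⟨C, hC, hB⟩ := Phi_bound G
  have hb := G.hb
  have hw0 := hw.self_of_nhds
  have hP : HasDerivAt (fun s => (γ s - a) ^ 2 + b ^ 2 : ℝ → ℂ) (2 * (γ t - a) * γ') t := by
    refine (((hγ.sub_const (a:ℂ)).pow 2).add_const _).congr_deriv ?_
    simp
  have hPO := hP.isBigO_sub
  have hgn : Tendsto (fun s => ‖g s‖) (𝓝 t) (𝓝 0) := by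
    have := hgc.tendsto.norm; rwa [h0, norm_zero] at this
  have hsmall : ∀ᶠ s in 𝓝 t, ‖g s‖ ^ 2 ≤ b ^ 2 / 2 := by
    have := hgn.pow 2
    rw [zero_pow two_ne_zero] at this
    exact this.eventually_le_const (by positivity)
  have hc := hγ.continuousAt
  have e1 := hc.eventually_ne hz1
  have e2 := hc.eventually_ne hz2
  have hP0 : Phi a b r1 r2 (γ t) (g t) = 0 := by
    have := hB (γ t) (g t) hz1 hz2 hw0 hsmall.self_of_nhds
    rw [h0] at this ⊢
    simpa using this
  rw [hasDerivAt_iff_isLittleO]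
  simp only [hP0, smul_zero, sub_zero]
  have b1 : (fun s => Phi a b r1 r2 (γ s) (g s)) =O[𝓝 t] fun s => ‖g s‖ * ‖g s‖ ^ 2 := by
    refine Asymptotics.IsBigO.of_bound C ?_
    filter_upwards [hw, hsmall, e1, e2] with s s1 s2 s3 s4
    have := hB _ _ s3 s4 s1 s2
    rw [Real.norm_eq_abs, Real.norm_of_nonneg (by positivity)]
    calc _ ≤ _ := this
      _ = _ := by ring
  refine b1.trans_isLittleO ?_
  have o1 : (fun s => ‖g s‖) =o[𝓝 t] fun _ => (1:ℝ) :=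
    (Asymptotics.isLittleO_one_iff ℝ).2 hgn
  have o2 : (fun s => ‖g s‖ ^ 2) =O[𝓝 t] fun s => s - t := by
    refine Asymptotics.IsBigO.trans ?_ hPO
    refine Asymptotics.IsBigO.of_bound 1 ?_
    filter_upwards [hw] with s s1
    rw [← s1, ← hw0, h0]
    simp
  simpa using o1.mul_isBigO o2

lemma path_lemma (G : Geo a b r1 r2 β δ) {γ g : ℝ → ℂ} (hγ : ContDiff ℝ 1 γ)
    (h0 : γ 0 = a - b * I) (hne : ∀ t ∈ Icc (0:ℝ) 1, γ t ≠ 1 ∧ γ t ≠ -1)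
    (hg : ContinuousOn g (Icc 0 1))
    (hw : ∀ t ∈ Icc (0:ℝ) 1, g t ^ 2 = (γ t - a) ^ 2 + b ^ 2) :
    (∫ t in (0:ℝ)..1, g t / ((γ t) ^ 2 - 1) * deriv γ t).re = Phi a b r1 r2 (γ 1) (g 1) := by
  set f : ℝ → ℂ := fun t => g t / ((γ t) ^ 2 - 1) * deriv γ t with hf
  have hb := G.hb
  have hb' : (b:ℂ) ≠ 0 := by exact_mod_cast hb.ne'
  have hγc : Continuous γ := hγ.continuous
  have hden : ∀ t ∈ Icc (0:ℝ) 1, (γ t) ^ 2 - 1 ≠ 0 := by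
    intro t ht
    rw [show (γ t) ^ 2 - 1 = (γ t - 1) * (γ t + 1) by ring]
    refine mul_ne_zero (sub_ne_zero.2 (hne t ht).1) ?_
    intro h; exact (hne t ht).2 (eq_neg_of_add_eq_zero_left h)
  have hfc : ContinuousOn f (Icc 0 1) :=
    (hg.div (by fun_prop) hden).mul (hγ.continuous_deriv le_rfl).continuousOn
  have hN0 : ContinuousOn (fun t => Real.log ‖N0 a b (γ t) (g t)‖) (Icc 0 1) := by
    refine ContinuousOn.log ?_ (fun t ht => norm_ne_zero_iff.2 (N0_ne hb (hw t ht)))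
    unfold N0
    exact (((hγc.continuousOn.sub continuousOn_const).add hg).div_const _).norm
  have hNp : ∀ p r : ℝ, r ^ 2 = (p - a) ^ 2 + b ^ 2 → (∀ t ∈ Icc (0:ℝ) 1, γ t ≠ p) →
      ContinuousOn (fun t => Real.log ‖Np a b p r (γ t) (g t)‖) (Icc 0 1) := by
    intro p r hr hp
    refine ContinuousOn.log ?_ (fun t ht => norm_ne_zero_iff.2 (Np_ne hb hr (hp t ht) (hw t ht)))
    unfold Np
    refine (ContinuousOn.div ?_ (by fun_prop) ?_).norm
    · fun_prop
    · intro t ht; exact mul_ne_zero hb' (sub_ne_zero.2 (hp t ht))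
  have hPc : ContinuousOn (fun t => Phi a b r1 r2 (γ t) (g t)) (Icc 0 1) := by
    unfold Phi
    refine (hN0.sub ((hNp 1 r1 G.r1sq ?_).const_mul _)).add ((hNp (-1) r2 G.r2sq ?_).const_mul _)
    · intro t ht; simpa using (hne t ht).1
    · intro t ht; simpa using (hne t ht).2
  have hint : IntervalIntegrable f MeasureTheory.volume 0 1 :=
    ContinuousOn.intervalIntegrable (by rwa [uIcc_of_le zero_le_one])
  have hIc : ContinuousOn (fun x => ∫ t in (0:ℝ)..x, f t) (Icc 0 1) := by
    have := intervalIntegral.continuousOn_primitive_interval' (a := (0:ℝ)) hint (by simp)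
    rwa [uIcc_of_le zero_le_one] at this
  let H : ℝ → ℝ := fun x => (∫ t in (0:ℝ)..x, f t).re - Phi a b r1 r2 (γ x) (g x)
  have hHc : ContinuousOn H (Icc 0 1) := (Complex.continuous_re.comp_continuousOn hIc).sub hPc
  have hHd : ∀ x ∈ Ioo (0:ℝ) 1, HasDerivAt H 0 x := by
    intro x hx
    have hxI : x ∈ Icc (0:ℝ) 1 := Ioo_subset_Icc_self hx
    have hnb : Icc (0:ℝ) 1 ∈ 𝓝 x := Icc_mem_nhds hx.1 hx.2
    have i1 : HasDerivAt (fun x => ∫ t in (0:ℝ)..x, f t) (f x) x := by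
      refine intervalIntegral.integral_hasDerivAt_right ?_ ?_ (hfc.continuousAt hnb)
      · refine hint.mono_set ?_
        rw [uIcc_of_le zero_le_one, uIcc_of_le hx.1.le]
        exact Icc_subset_Icc_right hx.2.le
      · exact ContinuousOn.stronglyMeasurableAtFilter isOpen_Ioo (hfc.mono Ioo_subset_Icc_self) x hx
    have i2 : HasDerivAt (fun x => (∫ t in (0:ℝ)..x, f t).re) (f x).re x :=
      (Complex.reCLM.hasFDerivAt.comp_hasDerivAt x i1)
    have hγd : HasDerivAt γ (deriv γ x) x :=
      (hγ.differentiable (by norm_num) x).hasDerivAt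
    have hev : ∀ᶠ s in 𝓝 x, g s ^ 2 = (γ s - a) ^ 2 + b ^ 2 := by
      filter_upwards [hnb] with s hs using hw s hs
    by_cases hg0 : g x = 0
    · have := i2.sub (Phi_deriv_zero G hγd (hne x hxI).1 (hne x hxI).2 (hg.continuousAt hnb) hev hg0)
      refine this.congr_deriv ?_
      simp [hf, hg0]
    · have := i2.sub (Phi_deriv G hγd (hne x hxI).1 (hne x hxI).2 (hg.continuousAt hnb) hev hg0)
      refine this.congr_deriv ?_
      simp [hf]
  have hH0 : H 0 = 0 := by
    have m0 : (0:ℝ) ∈ Icc (0:ℝ) 1 := by simp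
    have hg0 : g 0 = 0 := by
      have := hw 0 m0
      rw [h0] at this
      have e : (a - b * I - a : ℂ) ^ 2 + b ^ 2 = 0 := by
        linear_combination (b:ℂ) ^ 2 * Complex.I_sq
      rw [e] at this
      exact pow_eq_zero_iff two_ne_zero |>.1 this
    obtain ⟨C, hC, hB⟩ := Phi_bound G
    have := hB (γ 0) (g 0) (hne 0 m0).1 (hne 0 m0).2 (hw 0 m0) (by rw [hg0]; simp; positivity)
    rw [hg0] at this
    have hP : Phi a b r1 r2 (γ 0) 0 = 0 := by simpa using this
    simp [H, hg0, hP]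
  obtain ⟨c, hc, hc'⟩ := exists_hasDerivAt_eq_slope H (fun _ => 0) zero_lt_one hHc hHd
  have : H 1 = 0 := by
    rw [hH0] at hc'
    simp at hc'
    linarith
  exact sub_eq_zero.1 this
end

/-! ### Part 10 -/

section
variable {a b r1 r2 β δ : ℝ}

/-- The arc parametrised by an angle function. -/
def Tc (a b : ℝ) (u : ℝ → ℝ) (s : ℝ) : ℂ := Zf a b s (cexp (u s * I) ^ 2)

def Dc (u : ℝ → ℝ) (s : ℝ) : ℂ := (1 - s) - s * cexp (u s * I) ^ 2

lemma Tc_subP {u : ℝ → ℝ} {s : ℝ} (hD : Dc u s ≠ 0) :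
    Tc a b u s - (a + b * I) = s * cexp (u s * I) ^ 2 * (2 * I * b) / Dc u s := by
  rw [eq_div_iff hD, sub_mul, Tc, Zf]
  unfold Dc at *
  rw [div_mul_cancel₀ _ hD]
  ring

lemma Tc_subM {u : ℝ → ℝ} {s : ℝ} (hD : Dc u s ≠ 0) :
    Tc a b u s - (a - b * I) = (1 - s) * (2 * I * b) / Dc u s := by
  rw [eq_div_iff hD, sub_mul, Tc, Zf]
  unfold Dc at *
  rw [div_mul_cancel₀ _ hD]
  ring

lemma Tc_norm {u : ℝ → ℝ} {s : ℝ} (hs : s ∈ Icc (0:ℝ) 1) (hD : Dc u s ≠ 0) :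
    (1 - s) * ‖Tc a b u s - (a + b * I)‖ = s * ‖Tc a b u s - (a - b * I)‖ := by
  rw [Tc_subP hD, Tc_subM hD]
  have h1 : ‖(1 - s : ℂ)‖ = 1 - s := by
    rw [show (1 - s : ℂ) = ((1 - s : ℝ) : ℂ) by push_cast; ring, Complex.norm_real,
      Real.norm_of_nonneg (by linarith [hs.2])]
  have h2 : ‖(s : ℂ)‖ = s := by
    rw [Complex.norm_real, Real.norm_of_nonneg hs.1]
  rw [norm_div, norm_div, norm_mul, norm_mul, norm_mul (1 - s : ℂ), h1, h2, norm_pow,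
    Complex.norm_exp_ofReal_mul_I]
  ring

lemma sum_pos' (hb : 0 < b) (z : ℂ) : 0 < ‖z - (a + b * I)‖ + ‖z - (a - b * I)‖ := by
  by_contra h
  have h1 := norm_nonneg (z - (a + b * I))
  have h2 := norm_nonneg (z - (a - b * I))
  have e1 : ‖z - (a + b * I)‖ = 0 := by linarith
  have e2 : ‖z - (a - b * I)‖ = 0 := by linarith
  rw [norm_eq_zero, sub_eq_zero] at e1 e2
  rw [e1] at e2
  have := congrArg Complex.im e2
  simp at this
  linarith

lemma norm_eq_iff (hb : 0 < b) (z : ℂ) : ‖z - (a + b * I)‖ = ‖z - (a - b * I)‖ ↔ z.im = 0 := by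
  rw [← sq_eq_sq₀ (norm_nonneg _) (norm_nonneg _), Complex.sq_norm, Complex.sq_norm,
    Complex.normSq_apply, Complex.normSq_apply]
  simp
  constructor
  · intro h
    have : b * z.im = 0 := by linarith
    rcases mul_eq_zero.1 this with h | h
    · linarith
    · exact h
  · intro h; rw [h]; ring

lemma Tc_real (hb : 0 < b) {u : ℝ → ℝ} {s : ℝ} (hs : s ∈ Icc (0:ℝ) 1) (hD : Dc u s ≠ 0) :
    (Tc a b u s).im = 0 ↔ s = 1 / 2 := by
  rw [← norm_eq_iff (a := a) hb]
  have h := Tc_norm (a := a) (b := b) hs hD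
  have hp := sum_pos' (a := a) hb (Tc a b u s)
  constructor
  · intro e
    rw [e] at h hp
    have : ‖Tc a b u s - (a - b * I)‖ ≠ 0 := by intro h; rw [h] at hp; simp at hp
    have := mul_right_cancel₀ this h
    linarith
  · intro e
    rw [e] at h ⊢
    linarith

lemma Tc_inj (hb : 0 < b) {u : ℝ → ℝ} (hD : ∀ s ∈ Icc (0:ℝ) 1, Dc u s ≠ 0) :
    InjOn (Tc a b u) (Icc 0 1) := by
  intro s hs t ht h
  have h1 := Tc_norm (a := a) (b := b) hs (hD s hs)
  have h2 := Tc_norm (a := a) (b := b) ht (hD t ht)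
  have hp := sum_pos' (a := a) hb (Tc a b u s)
  rw [← h] at h2
  have : s * (‖Tc a b u s - (a + b * I)‖ + ‖Tc a b u s - (a - b * I)‖) =
    t * (‖Tc a b u s - (a + b * I)‖ + ‖Tc a b u s - (a - b * I)‖) := by linarith
  exact mul_right_cancel₀ hp.ne' this

lemma analyticAt_cast {f : ℝ → ℝ} {x : ℝ} (h : AnalyticAt ℝ f x) :
    AnalyticAt ℝ (fun s => (f s : ℂ)) x :=
  (Complex.ofRealCLM.analyticAt (f x)).comp h

lemma analyticAt_exp {f : ℝ → ℝ} {x : ℝ} (h : AnalyticAt ℝ f x) :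
    AnalyticAt ℝ (fun s => cexp (f s * I)) x := by
  have h1 : AnalyticAt ℝ (fun s => (f s : ℂ) * I) x := (analyticAt_cast h).mul analyticAt_const
  have h2 : AnalyticAt ℝ cexp ((f x : ℂ) * I) := (analyticAt_cexp (z := (f x : ℂ) * I)).restrictScalars
  exact AnalyticAt.fun_comp (f := fun s => (f s : ℂ) * I) h2 h1

lemma Dc_analyticAt {u : ℝ → ℝ} {s : ℝ} (hu : AnalyticAt ℝ u s) : AnalyticAt ℝ (Dc u) s := by
  have hi : AnalyticAt ℝ (fun s : ℝ => (s : ℂ)) s := analyticAt_cast analyticAt_id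
  exact (analyticAt_const.sub hi).sub (hi.mul ((analyticAt_exp hu).pow 2))

lemma Tc_analyticAt {u : ℝ → ℝ} {s : ℝ} (hu : AnalyticAt ℝ u s) (hD : Dc u s ≠ 0) :
    AnalyticAt ℝ (Tc a b u) s := by
  have hi : AnalyticAt ℝ (fun s : ℝ => (s : ℂ)) s := analyticAt_cast analyticAt_id
  have hn : AnalyticAt ℝ (fun s : ℝ => (1 - s) * (a + b * I) -
      s * cexp (u s * I) ^ 2 * (a - b * I) : ℝ → ℂ) s :=
    ((analyticAt_const.sub hi).mul analyticAt_const).sub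
      ((hi.mul ((analyticAt_exp hu).pow 2)).mul analyticAt_const)
  exact hn.div (Dc_analyticAt hu) hD

lemma Tc_deriv (hb : 0 < b) {u : ℝ → ℝ} {s : ℝ} (hu : AnalyticAt ℝ u s) (hD : Dc u s ≠ 0) :
    deriv (Tc a b u) s ≠ 0 := by
  have hb' : (b:ℂ) ≠ 0 := by exact_mod_cast hb.ne'
  have hud := hu.differentiableAt.hasDerivAt
  set u' := deriv u s
  have hi : HasDerivAt (fun s : ℝ => (s : ℂ)) 1 s := Complex.ofRealCLM.hasDerivAt
  have he : HasDerivAt (fun s => cexp (u s * I)) (cexp (u s * I) * (u' * I)) s :=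
    (hud.ofReal_comp.mul_const I).cexp
  have hW : HasDerivAt (fun s => cexp (u s * I) ^ 2) (2 * u' * I * cexp (u s * I) ^ 2) s := by
    refine (he.pow 2).congr_deriv ?_
    simp; ring
  set W := cexp (u s * I) ^ 2 with hWd
  have hn : HasDerivAt (fun s : ℝ => (1 - s) * (a + b * I) -
      s * cexp (u s * I) ^ 2 * (a - b * I) : ℝ → ℂ)
      (-1 * (a + b * I) - (1 * W + s * (2 * u' * I * W)) * (a - b * I)) s := by
    exact (((hi.const_sub 1).mul_const _)).sub ((hi.mul hW).mul_const _)
  have hd : HasDerivAt (Dc u) (-1 - (1 * W + s * (2 * u' * I * W))) s :=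
    ((hi.const_sub 1)).sub (hi.mul hW)
  have hT := hn.div hd hD
  have hT' : deriv (Tc a b u) s = _ := hT.deriv
  rw [hT', div_ne_zero_iff]
  refine ⟨?_, pow_ne_zero _ hD⟩
  have hW0 : W ≠ 0 := pow_ne_zero _ (Complex.exp_ne_zero _)
  have hfac : (-1 * (a + b * I) - (1 * W + s * (2 * u' * I * W)) * (a - b * I)) * Dc u s -
      ((1 - s) * (a + b * I) - s * W * (a - b * I)) * (-1 - (1 * W + s * (2 * u' * I * W))) =
      2 * I * b * W * (1 + 2 * s * (1 - s) * u' * I) := by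
    rw [Dc, ← hWd]; ring
  rw [hfac]
  refine mul_ne_zero (mul_ne_zero (mul_ne_zero (by simp) hb') hW0) ?_
  intro h
  have := congrArg Complex.re h
  simp [mul_assoc] at this

lemma Tc_zero {u : ℝ → ℝ} : Tc a b u 0 = a + b * I := by simp [Tc, Zf]
lemma Tc_one {u : ℝ → ℝ} : Tc a b u 1 = a - b * I := by
  have : cexp (u 1 * I) ^ 2 ≠ 0 := pow_ne_zero _ (Complex.exp_ne_zero _)
  simp [Tc, Zf]

lemma Tc_arc (hb : 0 < b) {u : ℝ → ℝ} (hu : ∀ s ∈ Icc (0:ℝ) 1, AnalyticAt ℝ u s)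
    (hD : ∀ s ∈ Icc (0:ℝ) 1, Dc u s ≠ 0) :
    ∃ γ : ℝ → ℂ, AnalyticOnNhd ℝ γ (Set.Icc 0 1) ∧ Set.InjOn γ (Set.Icc 0 1) ∧
    (∀ t ∈ Set.Icc (0 : ℝ) 1, deriv γ t ≠ 0) ∧
    γ 0 = a + b * I ∧ γ 1 = a - b * I ∧ γ '' Set.Icc 0 1 = Tc a b u '' Icc 0 1 :=
  ⟨Tc a b u, fun s hs => Tc_analyticAt (hu s hs) (hD s hs), Tc_inj hb hD,
    fun s hs => Tc_deriv hb (hu s hs) (hD s hs), Tc_zero, Tc_one, rfl⟩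

lemma Tc_arc_rev (hb : 0 < b) {u : ℝ → ℝ} (hu : ∀ s ∈ Icc (0:ℝ) 1, AnalyticAt ℝ u s)
    (hD : ∀ s ∈ Icc (0:ℝ) 1, Dc u s ≠ 0) :
    ∃ γ : ℝ → ℂ, AnalyticOnNhd ℝ γ (Set.Icc 0 1) ∧ Set.InjOn γ (Set.Icc 0 1) ∧
    (∀ t ∈ Set.Icc (0 : ℝ) 1, deriv γ t ≠ 0) ∧
    γ 0 = a - b * I ∧ γ 1 = a + b * I ∧ γ '' Set.Icc 0 1 = Tc a b u '' Icc 0 1 := by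
  have hm : ∀ s ∈ Icc (0:ℝ) 1, 1 - s ∈ Icc (0:ℝ) 1 := by
    intro s hs; constructor <;> linarith [hs.1, hs.2]
  refine ⟨fun s => Tc a b u (1 - s), ?_, ?_, ?_, ?_, ?_, ?_⟩
  · intro s hs
    have := Tc_analyticAt (a := a) (b := b) (hu _ (hm s hs)) (hD _ (hm s hs))
    exact this.fun_comp (f := fun s => 1 - s) (analyticAt_const.sub analyticAt_id)
  · intro s hs t ht h
    have := Tc_inj (a := a) hb hD (hm s hs) (hm t ht) h
    linarith
  · intro s hs
    rw [deriv_comp_const_sub]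
    exact neg_ne_zero.2 (Tc_deriv hb (hu _ (hm s hs)) (hD _ (hm s hs)))
  · simp [Tc_one]
  · simp [Tc_zero]
  · ext z
    constructor
    · rintro ⟨s, hs, rfl⟩; exact ⟨1 - s, hm s hs, rfl⟩
    · rintro ⟨s, hs, rfl⟩; exact ⟨1 - s, hm s hs, by simp⟩
end

/-! ### Part 11 -/

section
variable {a b r1 r2 β δ : ℝ}

lemma Pol_sq {c σ θ : ℝ} {z w : ℂ} (hp : Pol a b c σ θ z w) :
    w ^ 2 = (z - a) ^ 2 + b ^ 2 := by
  obtain ⟨hD, hz, hw⟩ := hp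
  generalize cexp (θ * I) = e at *
  have hz' : z - a = b * I * (c ^ 2 + σ ^ 2 * e ^ 2) / (c ^ 2 - σ ^ 2 * e ^ 2) := by
    rw [hz, eq_div_iff hD, sub_mul, div_mul_cancel₀ _ hD]; ring
  rw [hz', hw, div_pow, div_pow, div_add' _ _ _ (pow_ne_zero 2 hD)]
  congr 1
  linear_combination (4 * (b:ℂ) ^ 2 * c ^ 2 * σ ^ 2 * e ^ 2 -
    b ^ 2 * (c ^ 2 + σ ^ 2 * e ^ 2) ^ 2) * Complex.I_sq

lemma exp_sq_shift (θ : ℝ) (n : ℤ) : cexp ((θ + n * Real.pi : ℝ) * I) ^ 2 = cexp (θ * I) ^ 2 := by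
  rw [← Complex.exp_nat_mul, ← Complex.exp_nat_mul]
  rw [Complex.exp_eq_exp_iff_exists_int]
  exact ⟨n, by push_cast; ring⟩

lemma Zf_half {θ : ℝ} (h : Real.sin θ ≠ 0) :
    Zf a b (1 / 2 : ℝ) (cexp (θ * I) ^ 2) = ((a - b * Real.cos θ / Real.sin θ : ℝ) : ℂ) := by
  have h' : (Real.sin θ : ℂ) ≠ 0 := by exact_mod_cast h
  have hc : (Real.sin θ : ℂ) ^ 2 + (Real.cos θ : ℂ) ^ 2 = 1 := by
    exact_mod_cast Real.sin_sq_add_cos_sq θ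
  have half : ((1 / 2 : ℝ) : ℂ) = 1 / 2 := by norm_num
  have he := Complex.exp_ne_zero (θ * I)
  rw [Zf, half]
  simp only [Complex.ofReal_sub, Complex.ofReal_div, Complex.ofReal_mul]
  rw [exp_eq_cs] at he ⊢
  generalize (Real.sin θ : ℂ) = S at *
  generalize (Real.cos θ : ℂ) = C at *
  have hd : (1 - 1 / 2 : ℂ) - 1 / 2 * (C + S * I) ^ 2 = -I * S * (C + S * I) := by
    linear_combination (-1 / 2) * hc + (S ^ 2 / 2) * Complex.I_sq
  rw [hd, div_eq_iff (mul_ne_zero (mul_ne_zero (by simp) h') he), sub_mul (a:ℂ)]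
  have e2 : b * C / S * (-I * S * (C + S * I)) = -I * b * C * (C + S * I) := by
    field_simp
  rw [e2]
  linear_combination (a : ℂ) * hd + (-b * I / 2) * hc + (b * I * S ^ 2 / 2) * Complex.I_sq

lemma Zf_half_pos (G : Geo a b r1 r2 β δ) {θ : ℝ} (h : Real.sin θ ≠ 0) :
    (a - b * Real.cos θ / Real.sin θ) + 1 = r2 * Real.sin (θ - β) / Real.sin θ ∧
    (a - b * Real.cos θ / Real.sin θ) - 1 = r1 * Real.sin (θ - δ) / Real.sin θ := by
  have := G.c1
  have := G.c2
  have := G.s1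
  have := G.s2
  rw [Real.sin_sub, Real.sin_sub]
  constructor
  · field_simp
    linear_combination Real.sin θ * G.c2 - Real.cos θ * G.s2
  · field_simp
    linear_combination Real.sin θ * G.c1 - Real.cos θ * G.s1

/-- angle in arc parameter -/
def uf (ϑ : ℝ → ℝ) (s : ℝ) : ℝ := ϑ (4 * s * (1 - s))

lemma q_mem {s : ℝ} (hs : s ∈ Icc (0:ℝ) 1) : 4 * s * (1 - s) ∈ Icc (0:ℝ) 1 :=
  ⟨by nlinarith [hs.1, hs.2], by nlinarith [sq_nonneg (2 * s - 1)]⟩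

lemma uf_analytic {ϑ : ℝ → ℝ} (h : AnalyticOnNhd ℝ ϑ (Icc 0 1)) {s : ℝ} (hs : s ∈ Icc (0:ℝ) 1) :
    AnalyticAt ℝ (uf ϑ) s := by
  refine AnalyticAt.fun_comp (f := fun s : ℝ => 4 * s * (1 - s)) (h _ (q_mem hs)) ?_
  exact (analyticAt_const.mul analyticAt_id).mul (analyticAt_const.sub analyticAt_id)

/-- the square root along the arc -/
def gc (b : ℝ) (u : ℝ → ℝ) (s : ℝ) : ℂ :=
  2 * I * b * (√(1 - s) : ℝ) * (√s : ℝ) * cexp (u s * I) / Dc u s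

lemma sqrt_facts {s : ℝ} (hs : s ∈ Icc (0:ℝ) 1) :
    √(1 - s) ^ 2 = 1 - s ∧ √s ^ 2 = s ∧ √(1 - s) ^ 2 + √s ^ 2 = 1 ∧
      (2 * √(1 - s) * √s) ^ 2 = 4 * s * (1 - s) := by
  have h1 := Real.sq_sqrt (show 0 ≤ 1 - s by linarith [hs.2])
  have h2 := Real.sq_sqrt hs.1
  refine ⟨h1, h2, by linarith, ?_⟩
  rw [mul_pow, mul_pow, h1, h2]; ring

lemma arc_Pol {u : ℝ → ℝ} {s : ℝ} (hs : s ∈ Icc (0:ℝ) 1) (hD : Dc u s ≠ 0) :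
    Pol a b √(1 - s) √s (u s) (Tc a b u s) (gc b u s) := by
  obtain ⟨h1, h2, -, -⟩ := sqrt_facts hs
  have h1' : ((√(1 - s) : ℝ) : ℂ) ^ 2 = 1 - s := by exact_mod_cast h1
  have h2' : ((√s : ℝ) : ℂ) ^ 2 = s := by exact_mod_cast h2
  refine ⟨?_, ?_, ?_⟩
  · rw [h1', h2']; exact hD
  · rw [h1', h2']; rfl
  · rw [h1', h2']; rfl

lemma Dc_ne {u : ℝ → ℝ} {s : ℝ} (hs : s ∈ Icc (0:ℝ) 1) (hN : Ns β δ (4 * s * (1 - s)) (u s)) :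
    Dc u s ≠ 0 := by
  obtain ⟨h1, h2, h3, h4⟩ := sqrt_facts hs
  have h1' : ((√(1 - s) : ℝ) : ℂ) ^ 2 = 1 - s := by exact_mod_cast h1
  have h2' : ((√s : ℝ) : ℂ) ^ 2 = s := by exact_mod_cast h2
  have := D_ne (α := u s) h3
  rw [h4, h1', h2'] at this
  intro h
  unfold Dc at h
  rw [h] at this
  simp at this
  linarith [hN.1]

/-- abstract version of the level set -/
def GS (a b : ℝ) : Set ℂ :=
  {z | ∃ γ g : ℝ → ℂ, ContDiff ℝ 1 γ ∧ γ 0 = a - b * I ∧ γ 1 = z ∧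
    (∀ t ∈ Set.Icc (0 : ℝ) 1, γ t ≠ 1 ∧ γ t ≠ -1) ∧
    ContinuousOn g (Set.Icc 0 1) ∧
    (∀ t ∈ Set.Icc (0 : ℝ) 1, g t ^ 2 = (γ t - a) ^ 2 + b ^ 2) ∧
    (∫ t in (0:ℝ)..1, g t / ((γ t) ^ 2 - 1) * deriv γ t).re = 0}

lemma arc_sub (G : Geo a b r1 r2 β δ) {ϑ : ℝ → ℝ} (hϑ : AnalyticOnNhd ℝ ϑ (Icc 0 1))
    (h : ∀ q ∈ Icc (0:ℝ) 1, Ns β δ q (ϑ q) ∧ Ff β δ q (ϑ q) = 0) :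
    Tc a b (uf ϑ) '' Icc 0 1 ⊆ GS a b := by
  rintro _ ⟨s, hs, rfl⟩
  have hNs : ∀ x ∈ Icc (0:ℝ) 1, Ns β δ (4 * x * (1 - x)) (uf ϑ x) := fun x hx => (h _ (q_mem hx)).1
  have hD : ∀ x ∈ Icc (0:ℝ) 1, Dc (uf ϑ) x ≠ 0 := fun x hx => Dc_ne hx (hNs x hx)
  have hP : ∀ x (hx : x ∈ Icc (0:ℝ) 1), Pol a b √(1 - x) √x (uf ϑ x) (Tc a b (uf ϑ) x)
    (gc b (uf ϑ) x) := fun x hx => arc_Pol hx (hD x hx)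
  have hne : ∀ x ∈ Icc (0:ℝ) 1, Tc a b (uf ϑ) x ≠ 1 ∧ Tc a b (uf ϑ) x ≠ -1 := by
    intro x hx
    obtain ⟨h1, h2, h3, h4⟩ := sqrt_facts hx
    exact (hP x hx).ne G h3 (by rw [h4]; exact hNs x hx)
  let S : ℝ → ℝ := fun τ => 1 - (1 - s) * Real.sin (Real.pi / 2 * τ) ^ 2
  have hS : ∀ τ, S τ ∈ Icc (0:ℝ) 1 := by
    intro τ
    have h1 := Real.sin_sq_le_one (Real.pi / 2 * τ)
    have h2 := sq_nonneg (Real.sin (Real.pi / 2 * τ))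
    constructor <;> simp only [S] <;> nlinarith [hs.1, hs.2]
  have hS0 : S 0 = 1 := by simp [S]
  have hS1 : S 1 = s := by simp [S]
  have hSc : ContDiff ℝ 1 S := by
    have : ContDiff ℝ 1 (fun τ : ℝ => Real.sin (Real.pi / 2 * τ)) :=
      Real.contDiff_sin.comp (contDiff_const.mul contDiff_id)
    exact contDiff_const.sub (contDiff_const.mul (this.pow 2))
  have hTc : ContDiff ℝ 1 (fun τ => Tc a b (uf ϑ) (S τ)) := by
    rw [contDiff_iff_contDiffAt]
    intro τ
    have := (Tc_analyticAt (a := a) (b := b) (uf_analytic hϑ (hS τ)) (hD _ (hS τ))).contDiffAt (n := 1)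
    exact this.comp τ hSc.contDiffAt
  have hgc : Continuous (fun τ => gc b (uf ϑ) (S τ)) := by
    rw [continuous_iff_continuousAt]
    intro τ
    have h1 : ContinuousAt (gc b (uf ϑ)) (S τ) := by
      have hu := uf_analytic hϑ (hS τ)
      have c1 := (Dc_analyticAt hu).continuousAt
      have c2 := (analyticAt_exp hu).continuousAt
      have c3 : ContinuousAt (fun x : ℝ => ((√(1 - x) : ℝ) : ℂ)) (S τ) := by fun_prop
      have c4 : ContinuousAt (fun x : ℝ => ((√x : ℝ) : ℂ)) (S τ) := by fun_prop
      exact (((continuousAt_const.mul c3).mul c4).mul c2).div c1 (hD _ (hS τ))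
    exact h1.comp (f := S) hSc.continuous.continuousAt
  refine ⟨fun τ => Tc a b (uf ϑ) (S τ), fun τ => gc b (uf ϑ) (S τ), hTc, ?_, ?_, ?_,
    hgc.continuousOn, ?_, ?_⟩
  · simp only [hS0, Tc_one]
  · simp only [hS1]
  · intro t _; exact hne _ (hS t)
  · intro t _; exact Pol_sq (hP _ (hS t))
  · have := path_lemma G hTc (by simp only [hS0, Tc_one]) (fun t _ => hne _ (hS t))
      hgc.continuousOn (fun t _ => Pol_sq (hP _ (hS t)))
    rw [this]
    obtain ⟨h1, h2, h3, h4⟩ := sqrt_facts (hS 1)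
    rw [(hP _ (hS 1)).Phi G h3 (hne _ (hS 1)).1 (hne _ (hS 1)).2, h4]
    have := (h _ (q_mem (hS 1))).2
    unfold uf
    rw [this, mul_zero]

lemma GS_sub (G : Geo a b r1 r2 β δ) {ϑ : Fin 3 → ℝ → ℝ}
    (h : ∀ q ∈ Icc (0:ℝ) 1, ∀ θ, Ns β δ q θ → Ff β δ q θ = 0 →
      ∃ k, ∃ n : ℤ, θ = ϑ k q + n * Real.pi) {z : ℂ} (hz : z ∈ GS a b) :
    ∃ k, z ∈ Tc a b (uf (ϑ k)) '' Icc 0 1 := by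
  obtain ⟨γ, g, hγ, h0, rfl, hne, hg, hw, hI⟩ := hz
  rw [path_lemma G hγ h0 hne hg hw] at hI
  have m1 : (1:ℝ) ∈ Icc (0:ℝ) 1 := by simp
  obtain ⟨c, σ, θ, hc, hσ, hcs, hp⟩ := exists_Pol G.hb (hw 1 m1)
  rw [hp.Phi G hcs (hne 1 m1).1 (hne 1 m1).2] at hI
  have hN := hp.Ns G hcs (hne 1 m1).1 (hne 1 m1).2
  have hs : σ ^ 2 ∈ Icc (0:ℝ) 1 := ⟨sq_nonneg _, by nlinarith [sq_nonneg c]⟩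
  have hq : (2 * c * σ) ^ 2 = 4 * σ ^ 2 * (1 - σ ^ 2) := by
    linear_combination (4 * σ ^ 2) * hcs
  have hc2 : (c:ℂ) ^ 2 = 1 - ((σ ^ 2 : ℝ) : ℂ) := by
    have : c ^ 2 = 1 - σ ^ 2 := by linarith
    exact_mod_cast this
  obtain ⟨hD, hz, -⟩ := hp
  have key : ∃ k, γ 1 = Tc a b (uf (ϑ k)) (σ ^ 2) := by
    by_cases hcσ : c * σ = 0
    · refine ⟨0, ?_⟩
      rcases mul_eq_zero.1 hcσ with h | h
      · have : σ ^ 2 = 1 := by rw [h] at hcs; linarith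
        rw [this, Tc_one, hz]
        rw [h] at hD ⊢
        have hs' : (σ:ℂ) ^ 2 = 1 := by exact_mod_cast this
        rw [hs'] at hD ⊢
        simp at hD ⊢
      · have : c ^ 2 = 1 := by rw [h] at hcs; linarith
        rw [h, zero_pow two_ne_zero, Tc_zero, hz]
        rw [h]
        have hs' : (c:ℂ) ^ 2 = 1 := by exact_mod_cast this
        rw [hs']
        simp
    · have hF : Ff β δ ((2 * c * σ) ^ 2) θ = 0 := by
        rcases mul_eq_zero.1 hI with h | h
        · exfalso
          have h1 := G.h1
          have h2 := G.h2
          have h3 := G.hb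
          have : r1 * r2 / (2 * b) ≠ 0 := by positivity
          have : 2 * c * σ ≠ 0 := by rw [mul_assoc]; exact mul_ne_zero two_ne_zero hcσ
          rcases mul_eq_zero.1 h with h | h
          · exact pow_ne_zero 3 this h
          · contradiction
        · exact h
      rw [hq] at hF hN
      obtain ⟨k, n, hk⟩ := h _ (q_mem hs) θ hN hF
      refine ⟨k, ?_⟩
      rw [hz, Tc, Zf, uf, hk, exp_sq_shift, hc2]
      push_cast
      rfl
  obtain ⟨k, hk⟩ := key
  exact ⟨k, σ ^ 2, hs, hk.symm⟩
end

/-! ### Part 12 -/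

section
variable {a b r1 r2 β δ : ℝ}

lemma Tc_half (G : Geo a b r1 r2 β δ) {ϑ : ℝ → ℝ} {θ : ℝ} {n : ℤ} (h : θ = ϑ 1 + n * Real.pi)
    (hs : 0 < Real.sin θ) :
    (Tc a b (uf ϑ) (1 / 2)).re + 1 = r2 * Real.sin (θ - β) / Real.sin θ ∧
    (Tc a b (uf ϑ) (1 / 2)).re - 1 = r1 * Real.sin (θ - δ) / Real.sin θ := by
  have e : Tc a b (uf ϑ) (1 / 2) = ((a - b * Real.cos θ / Real.sin θ : ℝ) : ℂ) := by
    rw [← Zf_half hs.ne', h, exp_sq_shift, Tc, uf]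
    norm_num
  rw [e, Complex.ofReal_re]
  exact Zf_half_pos G hs.ne'

lemma arc_real (G : Geo a b r1 r2 β δ) {ϑ : ℝ → ℝ}
    (hD : ∀ x ∈ Icc (0:ℝ) 1, Dc (uf ϑ) x ≠ 0) :
    (∃! z : ℂ, z ∈ Tc a b (uf ϑ) '' Icc 0 1 ∧ z.im = 0) ∧
    ∀ z ∈ Tc a b (uf ϑ) '' Icc 0 1, z.im = 0 → z = Tc a b (uf ϑ) (1 / 2) := by
  have hm : (1 / 2 : ℝ) ∈ Icc (0:ℝ) 1 := by constructor <;> norm_num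
  have key : ∀ z ∈ Tc a b (uf ϑ) '' Icc 0 1, z.im = 0 → z = Tc a b (uf ϑ) (1 / 2) := by
    rintro _ ⟨s, hs, rfl⟩ h
    rw [(Tc_real G.hb hs (hD s hs)).1 h]
  refine ⟨⟨Tc a b (uf ϑ) (1 / 2), ⟨⟨_, hm, rfl⟩, (Tc_real G.hb hm (hD _ hm)).2 rfl⟩, ?_⟩, key⟩
  rintro z ⟨h1, h2⟩
  exact key z h1 h2

lemma int_pi_zero {x : ℝ} {n : ℤ} (h : x = n * Real.pi) (h0 : 0 < x) (h1 : x < Real.pi) : False := by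
  have hp := Real.pi_pos
  rw [h] at h0 h1
  have a1 : (0:ℝ) < n := by by_contra h; nlinarith
  have a2 : (n:ℝ) < 1 := by by_contra h; nlinarith
  have a1' : 0 < n := by exact_mod_cast a1
  have a2' : n < 1 := by exact_mod_cast a2
  omega

theorem main_abs (hb : 0 < b) : ∃ ΓL ΓC ΓR : Set ℂ,
      GS a b = ΓL ∪ ΓC ∪ ΓR ∧
      IsAnalyticArc ΓL (a + b * I) (a - b * I) ∧
      IsAnalyticArc ΓC (a + b * I) (a - b * I) ∧
      IsAnalyticArc ΓR (a - b * I) (a + b * I) ∧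
      (∃! z : ℂ, z ∈ ΓL ∧ z.im = 0) ∧
      (∀ z ∈ ΓL, z.im = 0 → z.re < -1) ∧
      (∃! z : ℂ, z ∈ ΓC ∧ z.im = 0) ∧
      (∀ z ∈ ΓC, z.im = 0 → -1 < z.re ∧ z.re < 1) ∧
      (∃! z : ℂ, z ∈ ΓR ∧ z.im = 0) ∧
      (∀ z ∈ ΓR, z.im = 0 → 1 < z.re) := by
  obtain ⟨r1, r2, β, δ, G⟩ := exists_geo a b hb
  have hβ := G.hβ
  have hβδ := G.hβδ
  have hδ := G.hδ
  have h1 := G.h1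
  have h2 := G.h2
  obtain ⟨ϑ, hϑ, H⟩ := Good_all hβ hβδ hδ
  have m1 : (1:ℝ) ∈ Icc (0:ℝ) 1 := by simp
  obtain ⟨x, y, z, x0, x1, y0, y1, z0, z1, fx, fy, fz⟩ := zeros_one hβ hβδ hδ
  obtain ⟨i, ni, hi⟩ := (H 1 m1).2 x
    (Ns_one_of hβ hβδ hδ x0 (by linarith) x1.ne (by linarith)) fx
  obtain ⟨j, nj, hj⟩ := (H 1 m1).2 y
    (Ns_one_of hβ hβδ hδ (by linarith) (by linarith) y0.ne' y1.ne) fy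
  obtain ⟨k, nk, hk⟩ := (H 1 m1).2 z
    (Ns_one_of hβ hβδ hδ (by linarith) z1 (by linarith) z0.ne') fz
  have hij : i ≠ j := by
    rintro rfl
    exact int_pi_zero (x := y - x) (n := nj - ni) (by push_cast; linarith) (by linarith) (by linarith)
  have hik : i ≠ k := by
    rintro rfl
    exact int_pi_zero (x := z - x) (n := nk - ni) (by push_cast; linarith) (by linarith) (by linarith)
  have hjk : j ≠ k := by
    rintro rfl
    exact int_pi_zero (x := z - y) (n := nk - nj) (by push_cast; linarith) (by linarith) (by linarith)
  have hall : ∀ l : Fin 3, l = i ∨ l = j ∨ l = k := by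
    intro l; omega
  have hu : ∀ l, ∀ s ∈ Icc (0:ℝ) 1, AnalyticAt ℝ (uf (ϑ l)) s := fun l s hs => uf_analytic (hϑ l) hs
  have hD : ∀ l, ∀ s ∈ Icc (0:ℝ) 1, Dc (uf (ϑ l)) s ≠ 0 := fun l s hs =>
    Dc_ne hs ((H _ (q_mem hs)).1 l).1
  have hsx : 0 < Real.sin x := Real.sin_pos_of_pos_of_lt_pi x0 (by linarith)
  have hsy : 0 < Real.sin y := Real.sin_pos_of_pos_of_lt_pi (by linarith) (by linarith)
  have hsz : 0 < Real.sin z := Real.sin_pos_of_pos_of_lt_pi (by linarith) (by linarith)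
  refine ⟨Tc a b (uf (ϑ i)) '' Icc 0 1, Tc a b (uf (ϑ j)) '' Icc 0 1, Tc a b (uf (ϑ k)) '' Icc 0 1,
    ?_, Tc_arc hb (hu i) (hD i), Tc_arc hb (hu j) (hD j), Tc_arc_rev hb (hu k) (hD k),
    (arc_real G (hD i)).1, ?_, (arc_real G (hD j)).1, ?_, (arc_real G (hD k)).1, ?_⟩
  · have S : ∀ l, Tc a b (uf (ϑ l)) '' Icc 0 1 ⊆ GS a b := fun l =>
      arc_sub G (hϑ l) (fun q hq => (H q hq).1 l)
    apply Subset.antisymm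
    · intro w hw
      obtain ⟨l, hl⟩ := GS_sub G (fun q hq => (H q hq).2) hw
      rcases hall l with rfl | rfl | rfl
      · exact Or.inl (Or.inl hl)
      · exact Or.inl (Or.inr hl)
      · exact Or.inr hl
    · exact union_subset (union_subset (S i) (S j)) (S k)
  · intro w hw h
    rw [(arc_real G (hD i)).2 w hw h]
    obtain ⟨e1, e2⟩ := Tc_half G hi hsx
    have : Real.sin (x - β) < 0 := Real.sin_neg_of_neg_of_neg_pi_lt (by linarith) (by linarith)
    have : r2 * Real.sin (x - β) / Real.sin x < 0 := div_neg_of_neg_of_pos (by nlinarith) hsx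
    linarith
  · intro w hw h
    rw [(arc_real G (hD j)).2 w hw h]
    obtain ⟨e1, e2⟩ := Tc_half G hj hsy
    have : Real.sin (y - δ) < 0 := Real.sin_neg_of_neg_of_neg_pi_lt (by linarith) (by linarith)
    have : r1 * Real.sin (y - δ) / Real.sin y < 0 := div_neg_of_neg_of_pos (by nlinarith) hsy
    have : 0 < Real.sin (y - β) := Real.sin_pos_of_pos_of_lt_pi (by linarith) (by linarith)
    have : 0 < r2 * Real.sin (y - β) / Real.sin y := by positivity
    constructor <;> linarith
  · intro w hw h
    rw [(arc_real G (hD k)).2 w hw h]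
    obtain ⟨e1, e2⟩ := Tc_half G hk hsz
    have : 0 < Real.sin (z - δ) := Real.sin_pos_of_pos_of_lt_pi (by linarith) (by linarith)
    have : 0 < r1 * Real.sin (z - δ) / Real.sin z := by positivity
    linarith
end

lemma zeta_eq {A B : ℝ} :
    zetaP A B = ((B ^ 2 - A ^ 2) / (A + B + 2) ^ 2 : ℝ) +
      (4 * √((A + 1) * (B + 1) * (-A - B - 1)) / (A + B + 2) ^ 2 : ℝ) * I ∧
    zetaM A B = ((B ^ 2 - A ^ 2) / (A + B + 2) ^ 2 : ℝ) -
      (4 * √((A + 1) * (B + 1) * (-A - B - 1)) / (A + B + 2) ^ 2 : ℝ) * I := by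
  unfold zetaP zetaM
  constructor <;> push_cast <;> ring

lemma GammaSet_eq {A B a b : ℝ} (hP : zetaP A B = a + b * I) (hM : zetaM A B = a - b * I) :
    GammaSet A B = GS a b := by
  have e : ∀ z : ℂ, (z - (a + b * I)) * (z - (a - b * I)) = (z - a) ^ 2 + b ^ 2 := by
    intro z; linear_combination (-(b:ℂ) ^ 2) * Complex.I_sq
  unfold GammaSet GS
  simp only [hP, hM, e]

/-- Lemma 1: `Γ` is the union of three analytic arcs `Γ_L`, `Γ_C`, `Γ_R`,
all connecting `ζ₊` and `ζ₋`; each arc meets the real line in exactly one point, and the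
intervals `(−∞,−1)`, `(−1,1)`, `(1,∞)` are cut by `Γ_L`, `Γ_C`, `Γ_R` respectively. -/
theorem gamma_is_union_of_three_analytic_arcs
    (A B : ℝ) (hA : -1 < A) (hA0 : A < 0) (hB : -1 < B) (hB0 : B < 0)
    (hAB : -2 < A + B) (hAB1 : A + B < -1) :
    ∃ ΓL ΓC ΓR : Set ℂ,
      GammaSet A B = ΓL ∪ ΓC ∪ ΓR ∧
      IsAnalyticArc ΓL (zetaP A B) (zetaM A B) ∧
      IsAnalyticArc ΓC (zetaP A B) (zetaM A B) ∧
      IsAnalyticArc ΓR (zetaM A B) (zetaP A B) ∧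
      (∃! z : ℂ, z ∈ ΓL ∧ z.im = 0) ∧
      (∀ z ∈ ΓL, z.im = 0 → z.re < -1) ∧
      (∃! z : ℂ, z ∈ ΓC ∧ z.im = 0) ∧
      (∀ z ∈ ΓC, z.im = 0 → -1 < z.re ∧ z.re < 1) ∧
      (∃! z : ℂ, z ∈ ΓR ∧ z.im = 0) ∧
      (∀ z ∈ ΓR, z.im = 0 → 1 < z.re) := by
  obtain ⟨hP, hM⟩ := zeta_eq (A := A) (B := B)
  have hb : 0 < 4 * √((A + 1) * (B + 1) * (-A - B - 1)) / (A + B + 2) ^ 2 := by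
    have h1 : 0 < A + 1 := by linarith
    have h2 : 0 < B + 1 := by linarith
    have h3 : 0 < -A - B - 1 := by linarith
    have h4 : 0 < A + B + 2 := by linarith
    have := Real.sqrt_pos.2 (mul_pos (mul_pos h1 h2) h3)
    positivity
  rw [GammaSet_eq hP hM, hP, hM]
  exact main_abs hb

end
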